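/- Let H be an ordered graph on h vertices with at least one edge and let η>0. Then there exist n₀∈ℕ and ν>0 such that the following holds: if G is an ordered graph on vertex set [n] with n ≥ n₀ and minimum degree δ(G) ≥ (1 − 1/χ<(H) + η)n, then [n] contains a set Abs with |Abs| ≤ νn such that Abs is an H-absorbing set for every W ⊆ [n]∖Abs with |W| divisible by h and |W| ≤ ν³n. -/

import Mathlib

open Finset

section Defs

variable {h n : ℕ}

/-- `φ` is an order-preserving embedding of the ordered graph `H` into the ordered graph `G`:
a strictly increasing map carrying edges of `H` to edges of `G`. -/
def IsOrderedCopy (H : SimpleGraph (Fin h)) (G : SimpleGraph (Fin n))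
    (φ : Fin h → Fin n) : Prop :=
  StrictMono φ ∧ ∀ i j : Fin h, H.Adj i j → G.Adj (φ i) (φ j)

/-- `S` is the vertex set of a copy of the ordered graph `H` in the ordered graph `G`. -/
def IsCopySet (H : SimpleGraph (Fin h)) (G : SimpleGraph (Fin n))
    (S : Finset (Fin n)) : Prop :=
  ∃ φ : Fin h → Fin n, IsOrderedCopy H G φ ∧ Finset.image φ Finset.univ = S

/-- `G` has an `H`-tiling (vertex-disjoint copies of `H`) whose copies exactly cover the
vertex set `S`; equivalently, the induced ordered subgraph `G[S]` has a perfect `H`-tiling. -/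
def HasPerfectTilingOn (H : SimpleGraph (Fin h)) (G : SimpleGraph (Fin n))
    (S : Finset (Fin n)) : Prop :=
  ∃ 𝒯 : Finset (Finset (Fin n)),
    (∀ T ∈ 𝒯, IsCopySet H G T) ∧
    (𝒯 : Set (Finset (Fin n))).PairwiseDisjoint id ∧
    𝒯.biUnion id = S

/-- `G` has a perfect `H`-tiling. -/
def HasPerfectTiling (H : SimpleGraph (Fin h)) (G : SimpleGraph (Fin n)) : Prop :=
  HasPerfectTilingOn H G Finset.univ

/-- The degree of a vertex in an ordered graph. -/
noncomputable def odeg (G : SimpleGraph (Fin n)) (v : Fin n) : ℕ :=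
  (G.neighborSet v).ncard

/-- `[h]` can be partitioned into `k` intervals, each independent in `H`
(expressed via a monotone colouring with independent fibres). -/
def HasIntervalColoring (H : SimpleGraph (Fin h)) (k : ℕ) : Prop :=
  ∃ c : Fin h → Fin k, Monotone c ∧ ∀ i j : Fin h, H.Adj i j → c i ≠ c j

/-- The interval chromatic number `χ<(H)` of an ordered graph. -/
noncomputable def intervalChi (H : SimpleGraph (Fin h)) : ℕ :=
  sInf {k | HasIntervalColoring H k}

/-- `α⁺ᵢ(H)`: `α⁺₀ = 0`, and `α⁺_{i+1}` is the largest `k ≤ h` such that the interval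
`[α⁺ᵢ + 1, k]` is independent in `H` (vertices are 1-indexed via `v ↦ (v : ℕ) + 1`). -/
noncomputable def alphaPlus (H : SimpleGraph (Fin h)) : ℕ → ℕ
  | 0 => 0
  | (i + 1) => sSup {k | k ≤ h ∧ ∀ a b : Fin h,
      alphaPlus H i + 1 ≤ (a : ℕ) + 1 → (a : ℕ) + 1 ≤ k →
      alphaPlus H i + 1 ≤ (b : ℕ) + 1 → (b : ℕ) + 1 ≤ k → ¬ H.Adj a b}

/-- `α⁻ᵢ(H)`: `α⁻₀ = h + 1`, and `α⁻_{i+1}` is the smallest `k ≥ 1` such that the interval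
`[k, α⁻ᵢ − 1]` is independent in `H`. -/
noncomputable def alphaMinus (H : SimpleGraph (Fin h)) : ℕ → ℕ
  | 0 => h + 1
  | (i + 1) => sInf {k | 1 ≤ k ∧ ∀ a b : Fin h,
      k ≤ (a : ℕ) + 1 → (a : ℕ) + 1 ≤ alphaMinus H i - 1 →
      k ≤ (b : ℕ) + 1 → (b : ℕ) + 1 ≤ alphaMinus H i - 1 → ¬ H.Adj a b}

/-- `α*(H) = min over 1 ≤ ℓ < χ<(H) of min{α⁺_ℓ/(ℓh), (h − α⁻_ℓ + 1)/(ℓh)}`. -/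
noncomputable def alphaStar (H : SimpleGraph (Fin h)) : ℝ :=
  sInf {x : ℝ | ∃ ℓ : ℕ, 1 ≤ ℓ ∧ ℓ < intervalChi H ∧
    (x = (alphaPlus H ℓ : ℝ) / (ℓ * h) ∨
     x = ((h : ℝ) - alphaMinus H ℓ + 1) / (ℓ * h))}

/-- `α*(H)` for ordered graphs with interval chromatic number 2:
`min{α⁺₁(H)/h, (h − α⁻₁(H) + 1)/h}`. -/
noncomputable def alphaStar2 (H : SimpleGraph (Fin h)) : ℝ :=
  min ((alphaPlus H 1 : ℝ) / h) (((h : ℝ) - alphaMinus H 1 + 1) / h)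

/-- Property A: no edges of `H` within `[1, ⌊h/2⌋ + 1]` nor within `[⌈h/2⌉, h]`. -/
def PropertyA (H : SimpleGraph (Fin h)) : Prop :=
  (∀ a b : Fin h, (a : ℕ) + 1 ≤ h / 2 + 1 → (b : ℕ) + 1 ≤ h / 2 + 1 → ¬ H.Adj a b) ∧
  (∀ a b : Fin h, (h + 1) / 2 ≤ (a : ℕ) + 1 → (h + 1) / 2 ≤ (b : ℕ) + 1 → ¬ H.Adj a b)

/-- Property B: for each partition of `[h]` into nonempty intervals `[1, i], [i+1, h]`
there is an edge of `H` between them. -/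
def PropertyB (H : SimpleGraph (Fin h)) : Prop :=
  ∀ i : ℕ, 1 ≤ i → i < h →
    ∃ a b : Fin h, H.Adj a b ∧ (a : ℕ) + 1 ≤ i ∧ i + 1 ≤ (b : ℕ) + 1

/-- `s(H)`: the smallest vertex adjacent to `h`, and `0` if `h` is isolated. -/
noncomputable def sOG (H : SimpleGraph (Fin h)) : ℕ :=
  sInf {k | ∃ a b : Fin h, H.Adj a b ∧ (a : ℕ) + 1 = k ∧ (b : ℕ) + 1 = h}

open Classical in
/-- `l(H)`: the largest vertex adjacent to `1`, and `h + 1` if `1` is isolated. -/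
noncomputable def lOG (H : SimpleGraph (Fin h)) : ℕ :=
  if ∃ a b : Fin h, H.Adj a b ∧ (a : ℕ) + 1 = 1 then
    sSup {k | ∃ a b : Fin h, H.Adj a b ∧ (a : ℕ) + 1 = 1 ∧ (b : ℕ) + 1 = k}
  else h + 1

/-- The vertex `h` has Property C: `s(H) ≥ 1` and there is an edge within `[s(H), h − 1]`. -/
def PropertyCLast (H : SimpleGraph (Fin h)) : Prop :=
  1 ≤ sOG H ∧ ∃ a b : Fin h, H.Adj a b ∧
    sOG H ≤ (a : ℕ) + 1 ∧ (a : ℕ) + 1 ≤ h - 1 ∧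
    sOG H ≤ (b : ℕ) + 1 ∧ (b : ℕ) + 1 ≤ h - 1

/-- The vertex `1` has Property C: `l(H) ≤ h` and there is an edge within `[2, l(H)]`. -/
def PropertyCFirst (H : SimpleGraph (Fin h)) : Prop :=
  lOG H ≤ h ∧ ∃ a b : Fin h, H.Adj a b ∧
    2 ≤ (a : ℕ) + 1 ∧ (a : ℕ) + 1 ≤ lOG H ∧
    2 ≤ (b : ℕ) + 1 ∧ (b : ℕ) + 1 ≤ lOG H

/-- `S` is an `H`-absorbing set for `W`: both `G[S]` and `G[S ∪ W]` have perfect `H`-tilings. -/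
def IsAbsorbingFor (H : SimpleGraph (Fin h)) (G : SimpleGraph (Fin n))
    (S W : Finset (Fin n)) : Prop :=
  HasPerfectTilingOn H G S ∧ HasPerfectTilingOn H G (S ∪ W)

end Defs

section Regularity

/-- The density `d(A,B) = e(A,B)/(|A||B|)` of a pair of vertex sets in a graph. -/
noncomputable def pairDensity {V : Type*} (G : SimpleGraph V) (A B : Finset V) : ℝ :=
  ({e : V × V | e.1 ∈ A ∧ e.2 ∈ B ∧ G.Adj e.1 e.2}.ncard : ℝ) /
    ((A.card : ℝ) * (B.card : ℝ))

/-- The pair `(A, B)` is `ε`-regular in `G`. -/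
def IsRegularPair {V : Type*} (G : SimpleGraph V) (A B : Finset V) (ε : ℝ) : Prop :=
  ∀ X ⊆ A, ∀ Y ⊆ B, ε * A.card ≤ (X.card : ℝ) → ε * B.card ≤ (Y.card : ℝ) →
    |pairDensity G A B - pairDensity G X Y| < ε

end Regularity

section Bottle

/-- The chromatic number of a finite graph. -/
noncomputable def chromNum {m : ℕ} (B : SimpleGraph (Fin m)) : ℕ :=
  sInf {k | ∃ c : Fin m → Fin k, ∀ x y : Fin m, B.Adj x y → c x ≠ c y}

/-- `σ(B)`: the smallest size of a colour class in any proper colouring of `B`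
with `χ(B)` colours. -/
noncomputable def sigmaMinCl {m : ℕ} (B : SimpleGraph (Fin m)) : ℕ :=
  sInf {c | ∃ C : Fin m → Fin (chromNum B),
    (∀ x y : Fin m, B.Adj x y → C x ≠ C y) ∧
    ∃ i : Fin (chromNum B), c = (Finset.univ.filter (fun v => C v = i)).card}

/-- The critical chromatic number `χ_cr(B) = (χ(B) − 1)·|B|/(|B| − σ(B))`. -/
noncomputable def critChrom {m : ℕ} (B : SimpleGraph (Fin m)) : ℝ :=
  ((chromNum B : ℝ) - 1) * m / ((m : ℝ) - sigmaMinCl B)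

/-- `φ` is an interval labeling of the complete multipartite graph with part function `p`
(with respect to some permutation `σ` of the parts). -/
def IsIntervalLabeling {m k : ℕ} (p : Fin m → Fin k) (φ : Equiv.Perm (Fin m)) : Prop :=
  ∃ σ : Equiv.Perm (Fin k), ∀ x y : Fin m, σ (p x) < σ (p y) → φ x < φ y

/-- `G` is (an isomorphic realisation of) the ordered blow-up `(B(t), φ)` of the complete
multipartite graph `B` with part function `p`: there is a block assignment `β` whose fibres
all have size `t`, compatible with the order induced by `φ`, with adjacency between blocks
given by `B`. -/
def IsOrderedBlowup {m k : ℕ} (p : Fin m → Fin k) (φ : Equiv.Perm (Fin m)) (t : ℕ)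
    {N : ℕ} (G : SimpleGraph (Fin N)) : Prop :=
  ∃ β : Fin N → Fin m,
    (∀ x : Fin m, {u : Fin N | β u = x}.ncard = t) ∧
    (∀ u v : Fin N, u ≤ v → φ (β u) ≤ φ (β v)) ∧
    (∀ u v : Fin N, G.Adj u v ↔ p (β u) ≠ p (β v))

/-- The complete multipartite graph with part function `p` is a bottlegraph assigned to `H`:
for every interval labeling `φ` there is a `t ≥ 1` such that the ordered blow-up `(B(t), φ)`
has a perfect `H`-tiling. -/
def IsBottlegraph {h m k : ℕ} (H : SimpleGraph (Fin h)) (p : Fin m → Fin k) : Prop :=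
  ∀ φ : Equiv.Perm (Fin m), IsIntervalLabeling p φ →
    ∃ t : ℕ, 0 < t ∧ ∀ (N : ℕ) (G : SimpleGraph (Fin N)),
      IsOrderedBlowup p φ t G → HasPerfectTiling H G

end Bottle

section Tilings

variable {h n : ℕ} {H : SimpleGraph (Fin h)} {G : SimpleGraph (Fin n)}

lemma IsCopySet.card_eq {S : Finset (Fin n)} (hS : IsCopySet H G S) : #S = h := by
  obtain ⟨φ, hφ, rfl⟩ := hS
  simp [Finset.card_image_of_injective _ hφ.1.injective]

lemma HasPerfectTilingOn.of_isCopySet {S : Finset (Fin n)} (hS : IsCopySet H G S) :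
    HasPerfectTilingOn H G S :=
  ⟨{S}, by simpa using hS, by simp, by simp⟩

lemma HasPerfectTilingOn.empty : HasPerfectTilingOn H G ∅ :=
  ⟨∅, by simp, by simp, by simp⟩

lemma HasPerfectTilingOn.union {A B : Finset (Fin n)} (hA : HasPerfectTilingOn H G A)
    (hB : HasPerfectTilingOn H G B) (hAB : Disjoint A B) :
    HasPerfectTilingOn H G (A ∪ B) := by
  obtain ⟨𝒜, hA₁, hA₂, rfl⟩ := hA
  obtain ⟨ℬ, hB₁, hB₂, rfl⟩ := hB
  refine ⟨𝒜 ∪ ℬ, ?_, ?_, ?_⟩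
  · intro T hT
    rcases Finset.mem_union.1 hT with hT | hT
    exacts [hA₁ T hT, hB₁ T hT]
  · rw [Finset.coe_union]
    refine (Set.pairwiseDisjoint_union).2 ⟨hA₂, hB₂, ?_⟩
    intro S hS T hT _
    exact Finset.disjoint_of_subset_left (Finset.subset_biUnion_of_mem id hS)
      (Finset.disjoint_of_subset_right (Finset.subset_biUnion_of_mem id hT) hAB)
  · rw [Finset.union_biUnion]

lemma HasPerfectTilingOn.biUnion {ι : Type*} [DecidableEq ι] (s : Finset ι)
    (f : ι → Finset (Fin n)) (hf : ∀ i ∈ s, HasPerfectTilingOn H G (f i))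
    (hd : (s : Set ι).PairwiseDisjoint f) : HasPerfectTilingOn H G (s.biUnion f) := by
  induction s using Finset.induction_on with
  | empty => simpa using HasPerfectTilingOn.empty
  | insert a s ha ih =>
    rw [Finset.biUnion_insert]
    refine (hf a (by simp)).union (ih (fun i hi => hf i (by simp [hi])) ?_) ?_
    · exact hd.subset (by simp)
    · rw [Finset.disjoint_biUnion_right]
      intro i hi
      exact hd (by simp) (by simp [hi]) (by rintro rfl; exact ha hi)

lemma HasPerfectTilingOn.exists_mem {A : Finset (Fin n)} (hA : HasPerfectTilingOn H G A)
    {x : Fin n} (hx : x ∈ A) : ∃ T ⊆ A, IsCopySet H G T ∧ x ∈ T := by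
  obtain ⟨𝒜, hA₁, -, rfl⟩ := hA
  obtain ⟨T, hT, hxT⟩ := Finset.mem_biUnion.1 hx
  exact ⟨T, Finset.subset_biUnion_of_mem id hT, hA₁ T hT, hxT⟩

/-- An injective family of vertices indexed by `[h]` that respects the order and the edges between
distinct classes of a monotone proper colouring of `H` spans a copy of `H`. -/
lemma isCopySet_of_coloring {r : ℕ} {c : Fin h → Fin r} (hc : Monotone c)
    (hH : ∀ i j, H.Adj i j → c i ≠ c j) {s : Fin h → Fin n} (hs : s.Injective)
    (hcs : ∀ i j, c i < c j → s i < s j ∧ G.Adj (s i) (s j)) :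
    IsCopySet H G (univ.image s) := by
  set σ := Tuple.sort s
  have hmono : StrictMono (s ∘ σ) :=
    (Tuple.monotone_sort s).strictMono_of_injective (hs.comp σ.injective)
  have hcσ : Monotone (c ∘ σ) := by
    intro i j hij
    by_contra! hlt
    exact absurd (hcs _ _ hlt).1 (not_lt.2 (hmono.monotone hij))
  have hσ : c ∘ σ = c := by
    rw [Tuple.comp_sort_eq_comp_iff_monotone.2 hcσ, Tuple.sort_eq_refl_iff_monotone.2 hc]
    rfl
  refine ⟨s ∘ σ, ⟨hmono, fun i j hij => ?_⟩, ?_⟩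
  · have hij' := hH i j hij
    rw [← hσ] at hij'
    rcases lt_or_gt_of_ne hij' with hlt | hlt
    · exact (hcs _ _ hlt).2
    · exact (hcs _ _ hlt).2.symm
  · rw [← Finset.image_image, Finset.image_univ_equiv]

/-- `S` is a nonempty absorbing set for `Q` that is disjoint from `Q`. -/
def IsDisjointAbsorber (H : SimpleGraph (Fin h)) (G : SimpleGraph (Fin n))
    (S Q : Finset (Fin n)) : Prop :=
  S.Nonempty ∧ Disjoint S Q ∧ IsAbsorbingFor H G S Q

open Classical in
lemma hasPerfectTilingOn_biUnion_union (k : ℕ) (𝓕 : Finset (Finset (Fin n)))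
    (hdisj : (𝓕 : Set (Finset (Fin n))).PairwiseDisjoint id)
    (htile : ∀ S ∈ 𝓕, HasPerfectTilingOn H G S) (W : Finset (Fin n)) (hW : #W = h * k)
    (hWd : Disjoint W (𝓕.biUnion id))
    (habs : ∀ Q : Finset (Fin n), #Q = h → k ≤ #{S ∈ 𝓕 | IsDisjointAbsorber H G S Q}) :
    HasPerfectTilingOn H G (𝓕.biUnion id ∪ W) := by
  induction k generalizing 𝓕 W with
  | zero =>
    have : W = ∅ := by simpa using hW
    rw [this, Finset.union_empty]
    exact HasPerfectTilingOn.biUnion _ _ htile hdisj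
  | succ k ih =>
    obtain ⟨Q, hQW, hQ⟩ := Finset.exists_subset_card_eq (s := W) (n := h) (by rw [hW]; nlinarith)
    obtain ⟨S, hS⟩ := Finset.card_pos.1 (lt_of_lt_of_le k.succ_pos (habs Q hQ))
    obtain ⟨hSF, -, hSQ, -, hSQt⟩ := Finset.mem_filter.1 hS
    have hFS : 𝓕.biUnion id = (𝓕.erase S).biUnion id ∪ S := by
      conv_lhs => rw [← Finset.insert_erase hSF, Finset.biUnion_insert]
      rw [Finset.union_comm]; rfl
    have hSd : Disjoint ((𝓕.erase S).biUnion id) S := by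
      rw [Finset.disjoint_biUnion_left]
      intro T hT
      exact hdisj (Finset.mem_of_mem_erase hT) hSF (Finset.ne_of_mem_erase hT)
    have hrest := ih (𝓕.erase S) (hdisj.subset (by simp))
      (fun T hT => htile T (Finset.mem_of_mem_erase hT)) (W \ Q)
      (by rw [Finset.card_sdiff_of_subset hQW, hW, hQ, Nat.mul_succ, Nat.add_sub_cancel])
      (Finset.disjoint_of_subset_left Finset.sdiff_subset
        (Finset.disjoint_of_subset_right (by rw [hFS]; exact Finset.subset_union_left) hWd))
      (fun Q' hQ' => by
        have := habs Q' hQ'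
        rw [Finset.filter_erase]
        have := Finset.pred_card_le_card_erase (s := {S ∈ 𝓕 | IsDisjointAbsorber H G S Q'}) (a := S)
        omega)
    rw [hFS] at hWd ⊢
    rw [Finset.disjoint_union_right] at hWd
    have : (𝓕.erase S).biUnion id ∪ S ∪ W = ((𝓕.erase S).biUnion id ∪ W \ Q) ∪ (S ∪ Q) := by
      ext x
      have : x ∈ Q → x ∈ W := fun hx => hQW hx
      simp only [Finset.mem_union, Finset.mem_sdiff]
      tauto
    rw [this]
    refine hrest.union hSQt ?_
    rw [Finset.disjoint_union_left, Finset.disjoint_union_right, Finset.disjoint_union_right]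
    exact ⟨⟨hSd, (Finset.disjoint_of_subset_left hQW hWd.1).symm⟩,
      Finset.disjoint_of_subset_left Finset.sdiff_subset hWd.2, Finset.sdiff_disjoint⟩

end Tilings

section Selection

open Classical in
/-- If every target `q` is served by a positive proportion of the sets `Φ ω`, even after removing
those that meet a given small set, then there is a small disjoint family of such sets in which all
targets are served often. -/
lemma exists_disjoint_family {V Ω I : Type*} [DecidableEq V] [Fintype Ω] [Nonempty Ω]
    [Fintype I] (Φ : Ω → Finset V) (A : Finset V → I → Prop) {c : ℝ} (hc₁ : c ≤ 1) {m L : ℕ}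
    (hΦ : ∀ ω, #(Φ ω) ≤ m) (hne : ∀ S q, A S q → S.Nonempty)
    (hcount : ∀ F : Finset V, #F ≤ L * m → ∀ q,
      c * Fintype.card Ω ≤ (#{ω | A (Φ ω) q ∧ Disjoint (Φ ω) F} : ℝ)) :
    ∀ i ≤ L, ∃ 𝓕 : Finset (Finset V), (𝓕 : Set (Finset V)).PairwiseDisjoint id ∧
      (∀ S ∈ 𝓕, ∃ q, A S q) ∧ #(𝓕.biUnion id) ≤ i * m ∧
      ∑ q, (1 / 2 : ℝ) ^ #{S ∈ 𝓕 | A S q} ≤ Fintype.card I * (1 - c / 2) ^ i := by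
  intro i
  induction i with
  | zero => exact fun _ => ⟨∅, by simp⟩
  | succ i ih =>
    intro hi
    obtain ⟨𝓕, hd, hA, hcard, hsum⟩ := ih (by omega)
    set F := 𝓕.biUnion id
    set g : I → ℝ := fun q => (1 / 2 : ℝ) ^ #{S ∈ 𝓕 | A S q}
    set w : Ω → I → ℝ := fun ω q => if A (Φ ω) q ∧ Disjoint (Φ ω) F then 1 / 2 else 1 with hw
    have hg : ∀ q, 0 ≤ g q := fun q => by positivity
    have hF : #F ≤ L * m := hcard.trans (Nat.mul_le_mul_right _ (by omega))
    have hwsum : ∀ q, ∑ ω, w ω q ≤ (1 - c / 2) * Fintype.card Ω := by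
      intro q
      have h1 : ∀ ω, w ω q = 1 - (if A (Φ ω) q ∧ Disjoint (Φ ω) F then 1 / 2 else 0 : ℝ) := by
        intro ω
        simp only [hw]
        split_ifs <;> norm_num
      simp only [h1, Finset.sum_sub_distrib, Finset.sum_ite, Finset.sum_const, Finset.card_univ,
        nsmul_eq_mul, mul_one, mul_zero, add_zero]
      have := hcount F hF q
      linarith
    obtain ⟨ω, -, hω⟩ := Finset.exists_le_of_sum_le (s := (univ : Finset Ω))
      (f := fun ω => ∑ q, g q * w ω q) (g := fun _ => (1 - c / 2) * ∑ q, g q)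
      Finset.univ_nonempty (by
        rw [Finset.sum_comm, Finset.sum_const, Finset.card_univ, nsmul_eq_mul, Finset.mul_sum,
          Finset.mul_sum]
        refine Finset.sum_le_sum fun q _ => ?_
        rw [← Finset.mul_sum]
        nlinarith [mul_le_mul_of_nonneg_left (hwsum q) (hg q)])
    have hbound : ∑ q, g q * w ω q ≤ Fintype.card I * (1 - c / 2) ^ (i + 1) := by
      refine hω.trans ?_
      rw [pow_succ]
      nlinarith [mul_le_mul_of_nonneg_left hsum (by linarith : 0 ≤ 1 - c / 2)]
    by_cases hcase : (∃ q, A (Φ ω) q) ∧ Disjoint (Φ ω) F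
    · have hnot : Φ ω ∉ 𝓕 := by
        intro hmem
        obtain ⟨⟨q, hq⟩, hdis⟩ := hcase
        obtain ⟨x, hx⟩ := hne _ _ hq
        exact Finset.disjoint_left.1 hdis hx (Finset.subset_biUnion_of_mem id hmem hx)
      refine ⟨insert (Φ ω) 𝓕, ?_, ?_, ?_, ?_⟩
      · rw [Finset.coe_insert]
        refine hd.insert fun T hT _ => ?_
        exact Finset.disjoint_of_subset_right (Finset.subset_biUnion_of_mem id hT) hcase.2
      · intro S hS
        rcases Finset.mem_insert.1 hS with rfl | hS
        exacts [hcase.1, hA S hS]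
      · rw [Finset.biUnion_insert]
        refine (Finset.card_union_le _ _).trans ?_
        have := hΦ ω
        simp only [id]
        nlinarith
      · refine le_trans (Finset.sum_le_sum fun q _ => ?_) hbound
        rw [Finset.filter_insert]
        simp only [g, hw]
        by_cases hq : A (Φ ω) q
        · rw [if_pos hq, if_pos ⟨hq, hcase.2⟩, Finset.card_insert_of_notMem (by simp [hnot]),
            pow_succ]
        · rw [if_neg hq, if_neg (fun h => hq h.1), mul_one]
    · refine ⟨𝓕, hd, hA, hcard.trans (Nat.mul_le_mul_right _ (by omega)), ?_⟩
      refine le_trans (Finset.sum_le_sum fun q _ => ?_) hbound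
      simp only [hw]
      rw [if_neg (fun h => hcase ⟨⟨q, h.1⟩, h.2⟩), mul_one]

end Selection

section Counting

lemma card_mul_pow_div_card_le_sum_pow {ι : Type*} (s : Finset ι) (f : ι → ℝ)
    (hf : ∀ i ∈ s, 0 ≤ f i) (hs : s.Nonempty) (p : ℕ) :
    #s * ((∑ i ∈ s, f i) / #s) ^ p ≤ ∑ i ∈ s, f i ^ p := by
  have hs' : (0 : ℝ) < #s := by exact_mod_cast hs.card_pos
  cases p with
  | zero => simp
  | succ p =>
    refine le_trans (le_of_eq ?_) (pow_sum_div_card_le_sum_pow hf p)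
    rw [div_pow, pow_succ (#s : ℝ)]
    field_simp

open Classical in
lemma density_pow_le_card_blowup_fin {V ι : Type*} [Fintype V] [Nonempty V] [Fintype ι]
    [DecidableEq ι] (k : ℕ) (P : (Fin k → V) → Prop) :
    ((#{v | P v} : ℝ) / Fintype.card V ^ k) ^ (Fintype.card ι ^ k) *
        Fintype.card V ^ (k * Fintype.card ι) ≤
      #{W : Fin k → ι → V | ∀ s : Fin k → ι, P fun a => W a (s a)} := by
  set n := Fintype.card V
  set t := Fintype.card ι
  have hn : (0 : ℝ) < n := by exact_mod_cast Fintype.card_pos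
  induction k with
  | zero =>
    have : ∀ W : Fin 0 → ι → V, (fun a => W a (Fin.elim0 a)) = Fin.elim0 := fun W => by
      ext a; exact a.elim0
    by_cases hP : P Fin.elim0
    · have h1 : ∀ v : Fin 0 → V, P v := fun v => by rwa [Subsingleton.elim v Fin.elim0]
      simp [h1]
    · have h1 : ∀ v : Fin 0 → V, ¬ P v := fun v => by rwa [Subsingleton.elim v Fin.elim0]
      simp [h1]
  | succ k ih =>
    set P' : (ι → V) → (Fin k → V) → Prop := fun w u => ∀ j, P (Fin.cons (w j) u)
    set B : (ι → V) → Finset (Fin k → ι → V) := fun w =>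
      {W : Fin k → ι → V | ∀ s : Fin k → ι, P' w fun a => W a (s a)}
    have hB : (#{W : Fin (k + 1) → ι → V | ∀ s : Fin (k + 1) → ι, P fun a => W a (s a)} : ℝ)
        = ∑ w : ι → V, (#(B w) : ℝ) := by
      rw [← Nat.cast_sum, Nat.cast_inj, ← Finset.card_sigma]
      symm
      refine Finset.card_bij (fun p _ => Fin.cons p.1 p.2) ?_ ?_ ?_
      · rintro ⟨w, W⟩ hW
        simp only [Finset.mem_sigma, Finset.mem_univ, true_and, B, Finset.mem_filter, P'] at hW
        simp only [Finset.mem_filter, Finset.mem_univ, true_and]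
        intro s
        convert hW (fun a => s a.succ) (s 0) using 1
        ext a
        refine Fin.cases ?_ (fun a => ?_) a <;> simp
      · rintro ⟨w, W⟩ - ⟨w', W'⟩ - heq
        obtain ⟨h1, h2⟩ := Fin.cons_injective2 heq
        simp only at h1 h2
        rw [h1, h2]
      · intro W hW
        simp only [Finset.mem_filter, Finset.mem_univ, true_and] at hW
        refine ⟨⟨W 0, fun a => W a.succ⟩, ?_, ?_⟩
        · simp only [Finset.mem_sigma, Finset.mem_univ, true_and, B, Finset.mem_filter, P']
          intro s j
          convert hW (Fin.cons j s) using 1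
          ext a
          refine Fin.cases ?_ (fun a => ?_) a <;> simp
        · exact Fin.cons_self_tail W
    set d : (Fin k → V) → ℕ := fun u => #{a : V | P (Fin.cons a u)}
    have hd : ((#{v | P v} : ℕ) : ℝ) = ∑ u, (d u : ℝ) := by
      rw [← Nat.cast_sum, Nat.cast_inj, ← Finset.card_sigma]
      symm
      refine Finset.card_bij (fun p _ => Fin.cons p.2 p.1) ?_ ?_ ?_
      · rintro ⟨u, a⟩ h
        simpa using h
      · rintro ⟨w, W⟩ - ⟨w', W'⟩ - heq
        obtain ⟨h1, h2⟩ := Fin.cons_injective2 heq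
        simp only at h1 h2
        rw [h1, h2]
      · intro v hv
        refine ⟨⟨Fin.tail v, v 0⟩, ?_, Fin.cons_self_tail v⟩
        simpa using hv
    have hdt : ∑ w : ι → V, ((#{u | P' w u} : ℕ) : ℝ) = ∑ u, (d u : ℝ) ^ t := by
      have : ∀ u, (d u : ℝ) ^ t = (#{w : ι → V | P' w u} : ℕ) := by
        intro u
        rw [← Nat.cast_pow, Nat.cast_inj]
        have : ({w : ι → V | P' w u} : Finset (ι → V)) =
            Fintype.piFinset fun _ : ι => ({a : V | P (Fin.cons a u)} : Finset V) := by
          ext w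
          simp [P', Fintype.mem_piFinset]
        rw [this, Fintype.card_piFinset, Finset.prod_const, Finset.card_univ]
      simp only [this]
      simp only [Finset.card_filter, Nat.cast_sum]
      rw [Finset.sum_comm]
    have hmean₁ : (n : ℝ) ^ k * ((#{v | P v} : ℝ) / n ^ (k + 1) * n) ^ t ≤
        ∑ u, (d u : ℝ) ^ t := by
      have := card_mul_pow_div_card_le_sum_pow (univ : Finset (Fin k → V)) (fun u => (d u : ℝ))
        (fun _ _ => by positivity) Finset.univ_nonempty t
      rw [← hd, Finset.card_univ, Fintype.card_fun, Fintype.card_fin] at this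
      push_cast at this
      refine le_trans (le_of_eq ?_) this
      congr 2
      rw [pow_succ]
      field_simp
      rfl
    have hmean₂ := card_mul_pow_div_card_le_sum_pow (univ : Finset (ι → V))
      (fun w => ((#{u | P' w u} : ℕ) : ℝ) / n ^ k)
      (fun _ _ => by positivity) Finset.univ_nonempty (t ^ k)
    rw [← Finset.sum_div, hdt, Finset.card_univ, Fintype.card_fun] at hmean₂
    push_cast at hmean₂
    calc _ = (n : ℝ) ^ t * ((n : ℝ) ^ k * ((#{v | P v} : ℝ) / n ^ (k + 1) * n) ^ t / n ^ k / n ^ t)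
            ^ (t ^ k) * n ^ (k * t) := by
          have : (n : ℝ) ^ k * ((#{v | P v} : ℝ) / n ^ (k + 1) * n) ^ t / n ^ k / n ^ t =
              ((#{v | P v} : ℝ) / n ^ (k + 1)) ^ t := by
            rw [mul_pow]; field_simp
          rw [this, ← pow_mul, ← pow_succ', add_mul, one_mul, pow_add]
          ring
      _ ≤ (n : ℝ) ^ t * ((∑ u, (d u : ℝ) ^ t) / n ^ k / n ^ t) ^ (t ^ k) * n ^ (k * t) := by
          gcongr
      _ ≤ (∑ w : ι → V, (((#{u | P' w u} : ℕ) : ℝ) / n ^ k) ^ (t ^ k)) * n ^ (k * t) := by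
          gcongr
      _ ≤ ∑ w : ι → V, (#(B w) : ℝ) := by
          rw [Finset.sum_mul]
          refine Finset.sum_le_sum fun w _ => ?_
          have hw := ih (P' w)
          refine le_trans (le_of_eq ?_) (hw.trans (le_of_eq ?_))
          · congr!
          · congr!
      _ = _ := hB.symm

open Classical in
/-- A `k`-ary relation of density `d` on `V` has at least `d ^ (t ^ k) * |V| ^ (k * t)` blow-ups
with `t` copies of each coordinate. -/
lemma density_pow_le_card_blowup {V ι κ : Type*} [Fintype V] [Nonempty V] [Fintype ι]
    [DecidableEq ι] [Fintype κ] [DecidableEq κ] (P : (κ → V) → Prop) :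
    ((#{v | P v} : ℝ) / Fintype.card V ^ Fintype.card κ) ^ (Fintype.card ι ^ Fintype.card κ) *
        Fintype.card V ^ (Fintype.card κ * Fintype.card ι) ≤
      #{W : κ → ι → V | ∀ s : κ → ι, P fun a => W a (s a)} := by
  set e := Fintype.equivFin κ
  have h1 := density_pow_le_card_blowup_fin (ι := ι) (Fintype.card κ)
    (fun v : Fin (Fintype.card κ) → V => P (v ∘ e))
  have h2 : #{v : Fin (Fintype.card κ) → V | P (v ∘ e)} = #{v : κ → V | P v} := by
    refine Finset.card_equiv (Equiv.arrowCongr e.symm (Equiv.refl V)) fun v => ?_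
    simp [Equiv.arrowCongr]
  have h3 : #{W : Fin (Fintype.card κ) → ι → V | ∀ s : Fin (Fintype.card κ) → ι,
        P ((fun a => W a (s a)) ∘ e)} =
      #{W : κ → ι → V | ∀ s : κ → ι, P fun a => W a (s a)} := by
    refine Finset.card_equiv (Equiv.arrowCongr e.symm (Equiv.refl (ι → V))) fun W => ?_
    simp only [Finset.mem_filter, Finset.mem_univ, true_and]
    constructor
    · intro h s
      convert h (s ∘ e.symm) using 2
      simp [Equiv.arrowCongr]
    · intro h s
      convert h (s ∘ e) using 2
      simp [Equiv.arrowCongr]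
  rw [h2, h3] at h1
  exact h1

open Classical in
/-- If the coordinates of a tuple can be chosen one after another, with at least `m` options each
time, then there are at least `m ^ k` tuples. -/
lemma pow_card_le_card_of_allowed {κ α : Type*} [Fintype κ] [DecidableEq κ] [Fintype α] [Nonempty α]
    (ρ : κ → ℕ) (allowed : κ → (κ → α) → Finset α) {m : ℝ} (hm : 0 ≤ m)
    (hdep : ∀ a v w, (∀ b, ρ b < ρ a → v b = w b) → allowed a v = allowed a w)
    (hcard : ∀ a v, m ≤ #(allowed a v)) :
    m ^ Fintype.card κ ≤ #{v : κ → α | ∀ a, v a ∈ allowed a v} := by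
  obtain ⟨x₀⟩ := ‹Nonempty α›
  suffices H : ∀ s : Finset κ, m ^ #s ≤
      #{v : κ → α | (∀ a ∉ s, v a = x₀) ∧ ∀ a ∈ s, v a ∈ allowed a v} by
    simpa using H univ
  intro s
  induction s using Finset.induction_on_max_value ρ with
  | empty =>
    have : (1 : ℕ) ≤ #{v : κ → α | (∀ a ∉ (∅ : Finset κ), v a = x₀) ∧
        ∀ a ∈ (∅ : Finset κ), v a ∈ allowed a v} :=
      Finset.card_pos.2 ⟨fun _ => x₀, by simp⟩
    simpa using this
  | insert a s ha hmax ih =>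
    set N : Finset (κ → α) := {v | (∀ a ∉ s, v a = x₀) ∧ ∀ a ∈ s, v a ∈ allowed a v}
    have hupd : ∀ b, ρ b ≤ ρ a → ∀ v w, allowed b (Function.update v a w) = allowed b v := by
      intro b hb v w
      refine hdep _ _ _ fun b' hb' => Function.update_of_ne ?_ _ _
      rintro rfl
      omega
    have hle : #(N.sigma fun v => allowed a v) ≤ #{v : κ → α |
        (∀ b ∉ insert a s, v b = x₀) ∧ ∀ b ∈ insert a s, v b ∈ allowed b v} := by
      refine Finset.card_le_card_of_injOn (fun p => Function.update p.1 a p.2) ?_ ?_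
      · rintro ⟨v, w⟩ hv
        simp only [Finset.coe_sigma, Set.mem_sigma_iff, Finset.mem_coe, N, Finset.mem_filter,
          Finset.mem_univ, true_and] at hv
        obtain ⟨⟨h1, h2⟩, h3⟩ := hv
        simp only [Finset.coe_filter, Finset.mem_univ, true_and, Set.mem_ofPred_eq]
        constructor
        · intro b hb
          rw [Finset.mem_insert, not_or] at hb
          rw [Function.update_of_ne hb.1, h1 b hb.2]
        · intro b hb
          rcases Finset.mem_insert.1 hb with rfl | hbs
          · rw [hupd _ le_rfl, Function.update_self]; exact h3
          · rw [hupd b (hmax b hbs), Function.update_of_ne (by rintro rfl; exact ha hbs)]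
            exact h2 b hbs
      · rintro ⟨v, w⟩ hv ⟨v', w'⟩ hv' heq
        simp only [Finset.coe_sigma, Set.mem_sigma_iff, Finset.mem_coe, N, Finset.mem_filter,
          Finset.mem_univ, true_and] at hv hv'
        have hw : w = w' := by simpa using congrFun heq a
        have hvv : v = v' := by
          ext b
          by_cases hb : b = a
          · rw [hb, hv.1.1 a ha, hv'.1.1 a ha]
          · simpa [hb] using congrFun heq b
        rw [hw, hvv]
    rw [Finset.card_insert_of_notMem ha, pow_succ]
    calc m ^ #s * m ≤ #N * m := by gcongr
      _ = ∑ v ∈ N, m := by simp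
      _ ≤ ∑ v ∈ N, (#(allowed a v) : ℝ) := Finset.sum_le_sum fun v _ => hcard a v
      _ = (#(N.sigma fun v => allowed a v) : ℕ) := by rw [Finset.card_sigma]; push_cast; rfl
      _ ≤ _ := by exact_mod_cast hle

open Classical in
/-- All but a small proportion of the tuples are injective and avoid a given small set. -/
lemma card_injective_avoiding_ge {κ V : Type*} [Fintype κ] [DecidableEq κ] [Fintype V] [Nonempty V]
    (F : Finset V) (hF : #F + Fintype.card κ ≤ Fintype.card V) :
    (1 - Fintype.card κ * ((#F + Fintype.card κ : ℝ) / Fintype.card V)) *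
        Fintype.card V ^ Fintype.card κ ≤
      #{v : κ → V | v.Injective ∧ ∀ a, v a ∉ F} := by
  set n := Fintype.card V
  set k := Fintype.card κ
  have hn : (0 : ℝ) < n := by exact_mod_cast Fintype.card_pos
  have hF' : (#F + k : ℝ) ≤ n := by exact_mod_cast hF
  set e := Fintype.equivFin κ
  set bad : κ → (κ → V) → Finset V := fun a v =>
    F ∪ ({b : κ | e b < e a} : Finset κ).image v
  have h1 := pow_card_le_card_of_allowed (α := V) (fun a : κ => (e a : ℕ))
    (fun a v => (bad a v)ᶜ) (m := n - (#F + k)) (by linarith) (by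
      intro a v w hvw
      simp only [bad]
      congr 2
      refine Finset.image_congr fun b hb => hvw b ?_
      simpa using hb) (by
      intro a v
      have h2 : #(bad a v) ≤ #F + k :=
        (Finset.card_union_le _ _).trans (Nat.add_le_add_left
          (Finset.card_image_le.trans (Finset.card_le_univ _)) _)
      have h3 := Finset.card_add_card_compl (bad a v)
      have h2' : (#(bad a v) : ℝ) ≤ #F + k := by exact_mod_cast h2
      have h3' : (#(bad a v) : ℝ) + #(bad a v)ᶜ = n := by exact_mod_cast h3
      linarith)
  have h2 : #{v : κ → V | ∀ a, v a ∈ (bad a v)ᶜ} ≤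
      #{v : κ → V | v.Injective ∧ ∀ a, v a ∉ F} := by
    refine Finset.card_le_card fun v hv => ?_
    simp only [Finset.mem_filter, Finset.mem_univ, true_and, Finset.mem_compl, bad,
      Finset.mem_union, not_or, Finset.mem_image, not_exists, not_and] at hv ⊢
    refine ⟨fun a b hab => ?_, fun a => (hv a).1⟩
    by_contra hne
    rcases lt_or_gt_of_ne (e.injective.ne hne) with hlt | hlt
    · exact (hv b).2 a hlt hab
    · exact (hv a).2 b hlt hab.symm
  refine le_trans ?_ (h1.trans (by exact_mod_cast h2))
  have h4 : (n - (#F + k) : ℝ) = (1 + -((#F + k) / n)) * n := by field_simp; ring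
  rw [h4, mul_pow]
  gcongr
  have h5 : (#F + k : ℝ) / n ≤ 1 := (div_le_one hn).2 hF'
  have := one_add_mul_le_pow (a := -((#F + k : ℝ) / n)) (by linarith) k
  linarith

end Counting

section Switching

variable {h n r : ℕ} {H : SimpleGraph (Fin h)} {G : SimpleGraph (Fin n)} {κ : Type*}

open Classical in
lemma exists_sorted_enumeration (v : κ → Fin n) (hv : v.Injective) (K : Finset κ) (hK : #K = r) :
    ∃ f : Fin r → κ, (∀ a, a ∈ K ↔ ∃ i, f i = a) ∧ StrictMono (v ∘ f) := by
  subst hK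
  set e := K.equivFin.symm
  set g : Fin #K → κ := fun i => (e i : κ)
  have hg : g.Injective := Subtype.val_injective.comp e.injective
  set σ := Tuple.sort (v ∘ g)
  refine ⟨g ∘ σ, fun a => ⟨fun ha => ⟨σ.symm (e.symm ⟨a, ha⟩), by simp [g]⟩, ?_⟩, ?_⟩
  · rintro ⟨i, rfl⟩
    exact (e (σ i)).2
  · exact (Tuple.monotone_sort (v ∘ g)).strictMono_of_injective
      ((hv.comp hg).comp σ.injective)

/-- `p` can take the place of `e` in some `r`-clique `K` of core nodes without disturbing the order
of the clique. -/
def Interchangeable (D : SimpleGraph (κ ⊕ Bool)) (v : κ ⊕ Bool → Fin n) (r : ℕ) (p : κ ⊕ Bool)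
    (e : κ) : Prop :=
  ∃ K : Finset κ, #K = r ∧ e ∈ K ∧
    (∀ a ∈ K, ∀ b ∈ K, a ≠ b → D.Adj (Sum.inl a) (Sum.inl b)) ∧
    ∀ a ∈ K, a ≠ e → D.Adj (Sum.inl a) p ∧ (v (Sum.inl a) < v p ↔ v (Sum.inl a) < v (Sum.inl e))

open Classical in
lemma exists_interchangeable {D : SimpleGraph (κ ⊕ Bool)} {v : κ ⊕ Bool → Fin n}
    (hv : v.Injective) {K : Finset κ} (hr : 0 < r) (hK : #K = r)
    (hclique : ∀ a ∈ K, ∀ b ∈ K, a ≠ b → D.Adj (Sum.inl a) (Sum.inl b)) {p : κ ⊕ Bool}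
    (hp : ∀ a ∈ K, D.Adj (Sum.inl a) p) :
    ∃ e ∈ K, Interchangeable D v r p e ∧
      ((∃ a ∈ K, v p < v (Sum.inl a)) → v p < v (Sum.inl e)) := by
  by_cases hex : ∃ a ∈ K, v p < v (Sum.inl a)
  · obtain ⟨a, ha, hpa⟩ := hex
    obtain ⟨e, he, hmin⟩ := Finset.exists_min_image {a ∈ K | v p < v (Sum.inl a)}
      (fun a => v (Sum.inl a)) ⟨a, by simp [ha, hpa]⟩
    rw [Finset.mem_filter] at he
    refine ⟨e, he.1, ⟨K, hK, he.1, hclique, fun a ha _ => ⟨hp a ha, fun h => h.trans he.2, ?_⟩⟩,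
      fun _ => he.2⟩
    intro hlt
    by_contra hnot
    have : v p < v (Sum.inl a) := lt_of_le_of_ne (not_lt.1 hnot) (hv.ne (hp a ha).ne')
    exact absurd (hmin a (by simp [ha, this])) (not_le.2 hlt)
  · push Not at hex
    obtain ⟨e, he, hmax⟩ := Finset.exists_max_image K (fun a => v (Sum.inl a))
      (Finset.card_pos.1 (hK ▸ hr))
    refine ⟨e, he, ⟨K, hK, he, hclique, fun a ha hae => ⟨hp a ha, ?_⟩⟩, ?_⟩
    · exact iff_of_true (lt_of_le_of_ne (hex a ha) (hv.ne (hp a ha).ne))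
        (lt_of_le_of_ne (hmax a ha) (hv.ne (by simpa using hae)))
    · rintro ⟨a, ha, hlt⟩
      exact absurd (hex a ha) (not_le.2 hlt)

/-- The graph whose edges join interchangeable nodes. -/
def interchangeGraph (D : SimpleGraph (κ ⊕ Bool)) (v : κ ⊕ Bool → Fin n) (r : ℕ) :
    SimpleGraph (κ ⊕ Bool) :=
  SimpleGraph.fromRel fun p p' => ∃ e, p' = Sum.inl e ∧ Interchangeable D v r p e

lemma Interchangeable.reachable {D : SimpleGraph (κ ⊕ Bool)} {v : κ ⊕ Bool → Fin n}
    {p : κ ⊕ Bool} {e : κ} (hpe : Interchangeable D v r p e) :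
    (interchangeGraph D v r).Reachable p (Sum.inl e) := by
  by_cases hne : p = Sum.inl e
  · rw [hne]
  · exact SimpleGraph.Adj.reachable
      ((SimpleGraph.fromRel_adj _ _ _).2 ⟨hne, Or.inl ⟨e, rfl, hpe⟩⟩)

open Classical in
lemma reachable_of_mem_clique {D : SimpleGraph (κ ⊕ Bool)} {v : κ ⊕ Bool → Fin n}
    (hv : v.Injective) {C : Finset κ} (hr : 0 < r) (hC : #C = r + 1)
    (hclique : ∀ a ∈ C, ∀ b ∈ C, a ≠ b → D.Adj (Sum.inl a) (Sum.inl b)) {a b : κ}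
    (ha : a ∈ C) (hb : b ∈ C) :
    (interchangeGraph D v r).Reachable (Sum.inl a) (Sum.inl b) := by
  obtain ⟨m, hm, hmax⟩ := Finset.exists_max_image C (fun a => v (Sum.inl a)) ⟨a, ha⟩
  suffices H : ∀ a ∈ C, (interchangeGraph D v r).Reachable (Sum.inl a) (Sum.inl m) from
    (H a ha).trans (H b hb).symm
  by_contra! hnot
  obtain ⟨a, ha, hna⟩ := hnot
  obtain ⟨d, hd, hdmax⟩ := Finset.exists_max_image
    {a ∈ C | ¬ (interchangeGraph D v r).Reachable (Sum.inl a) (Sum.inl m)}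
    (fun a => v (Sum.inl a)) ⟨a, by simp [ha, hna]⟩
  rw [Finset.mem_filter] at hd
  have hdm : m ≠ d := by
    rintro rfl
    exact hd.2 (SimpleGraph.Reachable.refl _)
  obtain ⟨e, he, hde, hlt⟩ := exists_interchangeable (r := r) hv (K := C.erase d) hr
    (by rw [Finset.card_erase_of_mem hd.1, hC]; rfl)
    (fun a ha b hb => hclique a (Finset.mem_of_mem_erase ha) b (Finset.mem_of_mem_erase hb))
    (p := Sum.inl d)
    (fun a ha => hclique a (Finset.mem_of_mem_erase ha) d hd.1 (Finset.ne_of_mem_erase ha))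
  have hlt := hlt ⟨m, Finset.mem_erase.2 ⟨hdm, hm⟩,
    lt_of_le_of_ne (hmax d hd.1) (hv.ne (by simpa using hdm.symm))⟩
  by_cases hem : (interchangeGraph D v r).Reachable (Sum.inl e) (Sum.inl m)
  · exact hd.2 (hde.reachable.trans hem)
  · exact absurd (hdmax e (by simp [Finset.mem_of_mem_erase he, hem])) (not_le.2 hlt)

/-- The vertices assigned to a node in a blow-up: several for a core node, only one for each of the
two end nodes. -/
def nodeVertex {ι : Type*} (x : Bool → Fin n) (W : κ → ι → Fin n) : κ ⊕ Bool → ι → Fin n :=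
  Sum.elim W fun s _ => x s

open Classical in
lemma Interchangeable.exists_isCopySet {D : SimpleGraph (κ ⊕ Bool)} {ι : Type*}
    {c : Fin h → Fin r} (hc : Monotone c) (hsurj : c.Surjective)
    (hH : ∀ i j, H.Adj i j → c i ≠ c j) {x : Bool → Fin n} {W : κ → ι → Fin n}
    (hinj : Function.Injective (Function.uncurry W))
    (hW : ∀ a b, D.Adj a b → ∀ t t' u u',
      G.Adj (nodeVertex x W a t) (nodeVertex x W b t') ∧
      (nodeVertex x W a t < nodeVertex x W b t' → nodeVertex x W a u < nodeVertex x W b u'))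
    (t₀ : ι) (hv : Function.Injective fun a => nodeVertex x W a t₀) {p : κ ⊕ Bool} {e : κ}
    (hpe : Interchangeable D (fun a => nodeVertex x W a t₀) r p e) (τ : Fin h → ι)
    (hτ : τ.Injective) :
    ∃ S : Finset (Fin n), (∀ z ∈ S, ∃ a i, z = W a (τ i)) ∧
      ∀ z ∉ S, ((∃ t, z = nodeVertex x W p t) ∨ ∃ t, z = W e t) → IsCopySet H G (insert z S) := by
  obtain ⟨K, hK, heK, hclique, hp⟩ := hpe
  obtain ⟨f, hfK, hf⟩ := exists_sorted_enumeration (fun a => nodeVertex x W (Sum.inl a) t₀)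
    (hv.comp Sum.inl_injective) K hK
  have hfinj : f.Injective := hf.injective.of_comp
  obtain ⟨j, hj⟩ := (hfK e).1 heK
  obtain ⟨i₀, hi₀⟩ := hsurj j
  have hfmem : ∀ i, f i ∈ K := fun i => (hfK _).2 ⟨i, rfl⟩
  have key : ∀ a b, D.Adj a b → nodeVertex x W a t₀ < nodeVertex x W b t₀ → ∀ t t',
      nodeVertex x W a t < nodeVertex x W b t' ∧
        G.Adj (nodeVertex x W a t) (nodeVertex x W b t') :=
    fun a b hab hlt t t' => ⟨(hW a b hab t₀ t₀ t t').2 hlt, (hW a b hab t t' t t').1⟩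
  refine ⟨(univ.erase i₀).image fun i => W (f (c i)) (τ i), ?_, ?_⟩
  · intro z hz
    obtain ⟨i, -, rfl⟩ := Finset.mem_image.1 hz
    exact ⟨_, _, rfl⟩
  · intro z hzS hz
    set s : Fin h → Fin n := Function.update (fun i => W (f (c i)) (τ i)) i₀ z with hs
    have hs0 : s i₀ = z := Function.update_self _ _ _
    have hs1 : ∀ i, i ≠ i₀ → s i = W (f (c i)) (τ i) := fun i hi => Function.update_of_ne hi _ _
    have himg : univ.image s =
        insert z ((univ.erase i₀).image fun i => W (f (c i)) (τ i)) := by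
      conv_lhs => rw [← Finset.insert_erase (Finset.mem_univ i₀), Finset.image_insert, hs0]
      congr 1
      exact Finset.image_congr fun i hi => hs1 i (Finset.ne_of_mem_erase hi)
    rw [← himg]
    have hzs : ∀ i, i ≠ i₀ → W (f (c i)) (τ i) ≠ z := by
      rintro i hi rfl
      exact hzS (Finset.mem_image_of_mem _ (by simp [hi]))
    refine isCopySet_of_coloring hc hH ?_ ?_
    · intro i i' hii
      by_cases hi : i = i₀ <;> by_cases hi' : i' = i₀
      · rw [hi, hi']
      · rw [hi, hs0, hs1 i' hi'] at hii
        exact absurd hii.symm (hzs i' hi')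
      · rw [hi', hs0, hs1 i hi] at hii
        exact absurd hii (hzs i hi)
      · rw [hs1 i hi, hs1 i' hi'] at hii
        have := @hinj (f (c i), τ i) (f (c i'), τ i') hii
        exact hτ (Prod.ext_iff.1 this).2
    · intro i i' hlt
      have hff := hf hlt
      have hne : f (c i) ≠ f (c i') := hfinj.ne hlt.ne
      by_cases hi : i = i₀ <;> by_cases hi' : i' = i₀
      · rw [hi, hi'] at hlt
        exact absurd hlt (lt_irrefl _)
      · subst hi
        rw [hs0, hs1 i' hi']
        have hne' : f (c i') ≠ e := by rw [← hj, ← hi₀]; exact hne.symm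
        have hfe : nodeVertex x W (Sum.inl e) t₀ < nodeVertex x W (Sum.inl (f (c i'))) t₀ := by
          rw [← hj, ← hi₀]; exact hff
        obtain ⟨hadj, hiff⟩ := hp _ (hfmem (c i')) hne'
        rcases hz with ⟨t, rfl⟩ | ⟨t, rfl⟩
        · refine key p (Sum.inl (f (c i'))) hadj.symm ?_ t (τ i')
          exact lt_of_le_of_ne (not_lt.1 fun h => lt_asymm hfe (hiff.1 h)) (hv.ne hadj.ne')
        · exact key (Sum.inl e) (Sum.inl (f (c i'))) (hclique _ heK _ (hfmem _) hne'.symm) hfe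
            t (τ i')
      · subst hi'
        rw [hs0, hs1 i hi]
        have hne' : f (c i) ≠ e := by rw [← hj, ← hi₀]; exact hne
        have hfe : nodeVertex x W (Sum.inl (f (c i))) t₀ < nodeVertex x W (Sum.inl e) t₀ := by
          rw [← hj, ← hi₀]; exact hff
        obtain ⟨hadj, hiff⟩ := hp _ (hfmem (c i)) hne'
        rcases hz with ⟨t, rfl⟩ | ⟨t, rfl⟩
        · exact key (Sum.inl (f (c i))) p hadj (hiff.2 hfe) (τ i) t
        · exact key (Sum.inl (f (c i))) (Sum.inl e) (hclique _ (hfmem _) _ heK hne') hfe (τ i) t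
      · rw [hs1 i hi, hs1 i' hi']
        exact key (Sum.inl (f (c i))) (Sum.inl (f (c i')))
          (hclique _ (hfmem _) _ (hfmem _) hne) hff (τ i) (τ i')

open Classical in
lemma exists_switching_set_of_path {D : SimpleGraph (κ ⊕ Bool)}
    {c : Fin h → Fin r} (hc : Monotone c) (hsurj : c.Surjective)
    (hH : ∀ i j, H.Adj i j → c i ≠ c j) {x : Bool → Fin n} (hx : x.Injective)
    {W : κ → (κ ⊕ Bool) × Option (Fin h) → Fin n}
    (hinj : Function.Injective (Function.uncurry W)) (havoid : ∀ a t s, W a t ≠ x s)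
    (hW : ∀ a b, D.Adj a b → ∀ t t' u u',
      G.Adj (nodeVertex x W a t) (nodeVertex x W b t') ∧
      (nodeVertex x W a t < nodeVertex x W b t' → nodeVertex x W a u < nodeVertex x W b u'))
    (t₀ : (κ ⊕ Bool) × Option (Fin h)) {u w : κ ⊕ Bool}
    (P : (interchangeGraph D (fun a => nodeVertex x W a t₀) r).Walk u w) (hP : P.IsPath) :
    u = w ∨ ∃ S : Finset (Fin n),
      (∀ z ∈ S, ∃ b ∈ P.support, z = nodeVertex x W b (b, none) ∨ ∃ a i, z = W a (b, some i)) ∧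
      nodeVertex x W u (u, none) ∉ S ∧ nodeVertex x W w (w, none) ∉ S ∧
      HasPerfectTilingOn H G (insert (nodeVertex x W u (u, none)) S) ∧
      HasPerfectTilingOn H G (insert (nodeVertex x W w (w, none)) S) := by
  have hinj' : ∀ a t a' t', W a t = W a' t' → a = a' ∧ t = t' := fun a t a' t' heq =>
    Prod.ext_iff.1 (@hinj (a, t) (a', t') heq)
  have hnode : ∀ t t', ∀ a b, nodeVertex x W a t = nodeVertex x W b t' → a = b := by
    rintro t t' (a | s) (b | s') heq
    · rw [(hinj' _ _ _ _ heq).1]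
    · exact absurd heq (havoid _ _ _)
    · exact absurd heq.symm (havoid _ _ _)
    · rw [hx heq]
  have hv : Function.Injective fun a => nodeVertex x W a t₀ := fun a b => hnode _ _ a b
  set O : κ ⊕ Bool → Fin n → Prop := fun b z =>
    z = nodeVertex x W b (b, none) ∨ ∃ a i, z = W a (b, some i) with hO
  have hrep : ∀ b, O b (nodeVertex x W b (b, none)) := fun b => Or.inl rfl
  have hnot : ∀ b u a i, nodeVertex x W b (b, none) ≠ W a (u, some i) := by
    rintro (b | s) u a i heq
    · simpa using (hinj' _ _ _ _ heq).2
    · exact havoid _ _ _ heq.symm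
  have hOuniq : ∀ b b' z, O b z → O b' z → b = b' := by
    rintro b b' z (rfl | ⟨a, i, rfl⟩) (hz | ⟨a', i', hz⟩)
    · exact hnode _ _ _ _ hz
    · exact absurd hz (hnot _ _ _ _)
    · exact absurd hz.symm (hnot _ _ _ _)
    · exact (Prod.ext_iff.1 (hinj' _ _ _ _ hz).2).1
  induction P with
  | nil => exact Or.inl rfl
  | @cons u u' w hadj P ih =>
    rw [SimpleGraph.Walk.cons_isPath_iff] at hP
    obtain ⟨hPpath, huP⟩ := hP
    right
    have huw : u ≠ w := fun h => huP (h ▸ P.end_mem_support)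
    have huu' : u ≠ u' := fun h => huP (h ▸ P.start_mem_support)
    obtain ⟨S₀, hS₀, hu, hu'⟩ : ∃ S₀ : Finset (Fin n), (∀ z ∈ S₀, ∃ a i, z = W a (u, some i)) ∧
        IsCopySet H G (insert (nodeVertex x W u (u, none)) S₀) ∧
        IsCopySet H G (insert (nodeVertex x W u' (u', none)) S₀) := by
      have hτ : Function.Injective fun i : Fin h => (u, some i) := fun i j hij => by
        simpa using hij
      rcases ((SimpleGraph.fromRel_adj _ _ _).1 hadj).2 with ⟨e, rfl, he⟩ | ⟨e, rfl, he⟩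
      all_goals
        obtain ⟨S, hS, hcopy⟩ := he.exists_isCopySet hc hsurj hH hinj hW t₀ hv _ hτ
        have hS' : ∀ b, nodeVertex x W b (b, none) ∉ S := by
          intro b hb
          obtain ⟨a, i, hai⟩ := hS _ hb
          exact hnot _ _ _ _ hai
      · exact ⟨S, hS, hcopy _ (hS' _) (Or.inl ⟨_, rfl⟩), hcopy _ (hS' _) (Or.inr ⟨_, rfl⟩)⟩
      · exact ⟨S, hS, hcopy _ (hS' _) (Or.inr ⟨_, rfl⟩), hcopy _ (hS' _) (Or.inl ⟨_, rfl⟩)⟩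
    have hS₀O : ∀ z ∈ S₀, O u z := fun z hz => Or.inr (hS₀ z hz)
    have hS₀rep : ∀ b, nodeVertex x W b (b, none) ∉ S₀ := by
      intro b hb
      obtain ⟨a, i, hai⟩ := hS₀ _ hb
      exact hnot _ _ _ _ hai
    rcases ih hPpath with rfl | ⟨S', hS', huS', hwS', htu, htw⟩
    · refine ⟨S₀, fun z hz => ⟨u, by simp, hS₀O z hz⟩, hS₀rep _, hS₀rep _,
        .of_isCopySet hu, .of_isCopySet hu'⟩
    · have hsupp : ∀ b ∈ P.support, ∀ z, O b z → ¬ O u z := fun b hb z hbz huz =>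
        huP (hOuniq _ _ _ huz hbz ▸ hb)
      by_cases hcase : u' = w
      · subst hcase
        exact ⟨S₀, fun z hz => ⟨u, by simp, hS₀O z hz⟩, hS₀rep _, hS₀rep _,
          .of_isCopySet hu, .of_isCopySet hu'⟩
      have hne : nodeVertex x W u' (u', none) ≠ nodeVertex x W w (w, none) :=
        fun h' => hcase (hnode _ _ _ _ h')
      have hS'u : ∀ z ∈ S', ¬ O u z := fun z hz => by
        obtain ⟨b, hb, hbz⟩ := hS' z hz
        exact hsupp b hb z hbz
      have hd1 : Disjoint (insert (nodeVertex x W u (u, none)) S₀)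
          (insert (nodeVertex x W u' (u', none)) S') := by
        rw [Finset.disjoint_left]
        intro z hz hz'
        have hOu : O u z := by
          rcases Finset.mem_insert.1 hz with rfl | hz
          exacts [hrep u, hS₀O z hz]
        rcases Finset.mem_insert.1 hz' with rfl | hz'
        · exact huu' (hOuniq _ _ _ hOu (hrep u'))
        · exact hS'u z hz' hOu
      have hd2 : Disjoint (insert (nodeVertex x W u' (u', none)) S₀)
          (insert (nodeVertex x W w (w, none)) S') := by
        rw [Finset.disjoint_left]
        intro z hz hz'
        rcases Finset.mem_insert.1 hz with rfl | hz <;>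
          rcases Finset.mem_insert.1 hz' with hz' | hz'
        · exact hne hz'
        · exact huS' hz'
        · exact hS₀rep _ (hz' ▸ hz)
        · exact hS'u z hz' (hS₀O z hz)
      refine ⟨S₀ ∪ insert (nodeVertex x W u' (u', none)) S', ?_, ?_, ?_, ?_, ?_⟩
      · intro z hz
        rcases Finset.mem_union.1 hz with hz | hz
        · exact ⟨u, by simp, hS₀O z hz⟩
        rcases Finset.mem_insert.1 hz with rfl | hz
        · exact ⟨u', by simp, hrep u'⟩
        · obtain ⟨b, hb, hbz⟩ := hS' z hz
          exact ⟨b, by simp [hb], hbz⟩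
      · rw [Finset.mem_union, not_or]
        exact ⟨hS₀rep _, fun hz => Finset.disjoint_left.1 hd1 (Finset.mem_insert_self _ _) hz⟩
      · rw [Finset.mem_union, Finset.mem_insert, not_or, not_or]
        exact ⟨hS₀rep _, hne.symm, hwS'⟩
      · rw [← Finset.insert_union]
        exact (HasPerfectTilingOn.of_isCopySet hu).union htu hd1
      · rw [← Finset.union_insert, Finset.insert_comm, Finset.union_insert, ← Finset.insert_union]
        exact (HasPerfectTilingOn.of_isCopySet hu').union htw hd2

open Classical in
/-- A blow-up of two `(r + 1)`-cliques sharing a node contains a set that can be tiled together with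
either one of two vertices, each of which is joined to all but one node of a clique. -/
lemma exists_switching_set [Fintype κ] {D : SimpleGraph (κ ⊕ Bool)} {C : Bool → Finset κ} {t : κ}
    {e : Bool → κ} (hC : ∀ s, #(C s) = r + 1) (ht : ∀ s, t ∈ C s) (he : ∀ s, e s ∈ C s)
    (hclique : ∀ s, ∀ a ∈ C s, ∀ b ∈ C s, a ≠ b → D.Adj (Sum.inl a) (Sum.inl b))
    (hCx : ∀ s, ∀ a ∈ C s, a ≠ e s → D.Adj (Sum.inl a) (Sum.inr s))
    {c : Fin h → Fin r} (hc : Monotone c) (hsurj : c.Surjective) (hr : 0 < r)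
    (hH : ∀ i j, H.Adj i j → c i ≠ c j) {x : Bool → Fin n} (hx : x.Injective)
    {W : κ → (κ ⊕ Bool) × Option (Fin h) → Fin n}
    (hinj : Function.Injective (Function.uncurry W)) (havoid : ∀ a t s, W a t ≠ x s)
    (hW : ∀ a b, D.Adj a b → ∀ t t' u u',
      G.Adj (nodeVertex x W a t) (nodeVertex x W b t') ∧
      (nodeVertex x W a t < nodeVertex x W b t' → nodeVertex x W a u < nodeVertex x W b u')) :
    ∃ S ⊆ univ.image (Function.uncurry W),
      HasPerfectTilingOn H G (insert (x false) S) ∧ HasPerfectTilingOn H G (insert (x true) S) := by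
  set t₀ : (κ ⊕ Bool) × Option (Fin h) := (Sum.inr true, none)
  have hv : Function.Injective fun a => nodeVertex x W a t₀ := by
    rintro (a | s) (b | s') heq
    · exact congrArg Sum.inl (Prod.ext_iff.1 (@hinj (a, t₀) (b, t₀) heq)).1
    · exact absurd heq (havoid _ _ _)
    · exact absurd heq.symm (havoid _ _ _)
    · rw [hx heq]
  have hreach : ∀ s, (interchangeGraph D (fun a => nodeVertex x W a t₀) r).Reachable
      (Sum.inr s) (Sum.inl t) := by
    intro s
    obtain ⟨d, hd, hlink, -⟩ := exists_interchangeable (r := r) hv (K := (C s).erase (e s)) hr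
      (by rw [Finset.card_erase_of_mem (he s), hC]; rfl)
      (fun a ha b hb => hclique s a (Finset.mem_of_mem_erase ha) b (Finset.mem_of_mem_erase hb))
      (p := Sum.inr s)
      (fun a ha => hCx s a (Finset.mem_of_mem_erase ha) (Finset.ne_of_mem_erase ha))
    exact hlink.reachable.trans
      (reachable_of_mem_clique hv hr (hC s) (hclique s) (Finset.mem_of_mem_erase hd) (ht s))
  obtain ⟨P, hP⟩ := ((hreach false).trans (hreach true).symm).exists_isPath
  rcases exists_switching_set_of_path hc hsurj hH hx hinj havoid hW t₀ P hP with
    heq | ⟨S, hS, h0, h1, ht0, ht1⟩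
  · simp at heq
  · refine ⟨S, fun z hz => ?_, ht0, ht1⟩
    rw [Finset.mem_image]
    obtain ⟨b, -, rfl | ⟨a, i, rfl⟩⟩ := hS z hz
    · rcases b with b | (_ | _)
      · exact ⟨(b, (Sum.inl b, none)), by simp, rfl⟩
      · exact absurd hz h0
      · exact absurd hz h1
    · exact ⟨(a, (b, some i)), by simp, rfl⟩

end Switching

section Template

/-- Two cliques on `r + 1` nodes sharing exactly the node `none`, together with two end nodes, each
joined to all nodes but the last one of one of the cliques. -/
def cliquePair (r : ℕ) : SimpleGraph (Option (Bool × Fin r) ⊕ Bool) where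
  Adj
    | .inl none, .inl none => False
    | .inl none, _ => True
    | _, .inl none => True
    | .inl (some (s, i)), .inl (some (s', j)) => s = s' ∧ i ≠ j
    | .inl (some (s, i)), .inr s' => s = s' ∧ (i : ℕ) + 1 < r
    | .inr s', .inl (some (s, i)) => s = s' ∧ (i : ℕ) + 1 < r
    | .inr _, .inr _ => False
  symm := by
    constructor
    rintro ((_ | ⟨s, i⟩) | s) ((_ | ⟨s', j⟩) | s') hab <;> first | trivial | skip
    exact ⟨hab.1.symm, hab.2.symm⟩
  loopless := by
    constructor
    rintro ((_ | ⟨s, i⟩) | s) hab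
    · exact hab
    · exact hab.2 rfl
    · exact hab

/-- The core nodes of `cliquePair` are chosen in the order given by this rank. -/
def cliquePairRank (r : ℕ) : Option (Bool × Fin r) → ℕ
  | none => 0
  | some (_, i) => i + 1

lemma cliquePairRank_ne {r : ℕ} {a b : Option (Bool × Fin r)}
    (hab : (cliquePair r).Adj (.inl a) (.inl b)) : cliquePairRank r a ≠ cliquePairRank r b := by
  rcases a with _ | ⟨s, i⟩ <;> rcases b with _ | ⟨s', j⟩
  · exact absurd hab id
  · simp [cliquePairRank]
  · simp [cliquePairRank]
  · simpa [cliquePairRank, Fin.ext_iff] using hab.2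

open Classical in
/-- The neighbours of a core node that are end nodes or core nodes of smaller rank. -/
noncomputable def cliquePairPrev (r : ℕ) (a : Option (Bool × Fin r)) :
    Finset (Option (Bool × Fin r) ⊕ Bool) :=
  {b | (cliquePair r).Adj b (.inl a) ∧ ∀ b', b = .inl b' → cliquePairRank r b' < cliquePairRank r a}

lemma card_cliquePairPrev_le {r : ℕ} (hr : 2 ≤ r) (a : Option (Bool × Fin r)) :
    #(cliquePairPrev r a) ≤ r := by
  classical
  rcases a with _ | ⟨s, i⟩
  · have hsub : cliquePairPrev r none ⊆ {.inr false, .inr true} := by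
      rintro (b | (_ | _)) hb
      · simp [cliquePairPrev, cliquePairRank] at hb
      · simp
      · simp
    exact (Finset.card_le_card hsub).trans (Finset.card_le_two.trans hr)
  · have hcore : ∀ b' : Option (Bool × Fin r), .inl b' ∈ cliquePairPrev r (some (s, i)) →
        (Sum.inl b' : Option (Bool × Fin r) ⊕ Bool) ∈
        insert (Sum.inl none : Option (Bool × Fin r) ⊕ Bool)
          ((Finset.Iio i).image fun j => Sum.inl (some (s, j))) := by
      rintro (_ | ⟨s', j⟩) hb
      · simp
      · obtain ⟨hb₁, hb₂⟩ := (Finset.mem_filter.1 hb).2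
        have hlt := hb₂ _ rfl
        have hs : s' = s := hb₁.1
        have hji : j < i := by simpa [cliquePairRank] using hlt
        simp [hs, hji]
    have hcard : #(insert (Sum.inl none : Option (Bool × Fin r) ⊕ Bool)
        ((Finset.Iio i).image fun j => (Sum.inl (some (s, j)) : Option (Bool × Fin r) ⊕ Bool))) ≤
          i + 1 := by
      refine (Finset.card_insert_le _ _).trans (Nat.add_le_add_right ?_ 1)
      exact Finset.card_image_le.trans (by simp)
    by_cases hi : (i : ℕ) + 1 < r
    · have hsub : cliquePairPrev r (some (s, i)) ⊆ insert (.inr s)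
          (insert (Sum.inl none : Option (Bool × Fin r) ⊕ Bool)
            ((Finset.Iio i).image fun j => Sum.inl (some (s, j)))) := by
        rintro (b | s') hb
        · exact Finset.mem_insert_of_mem (hcore b hb)
        · have hs : s = s' := (Finset.mem_filter.1 hb).2.1.1
          simp [hs]
      exact (Finset.card_le_card hsub).trans ((Finset.card_insert_le _ _).trans (by omega))
    · have hsub : cliquePairPrev r (some (s, i)) ⊆
          insert (Sum.inl none : Option (Bool × Fin r) ⊕ Bool)
            ((Finset.Iio i).image fun j => Sum.inl (some (s, j))) := by
        rintro (b | s') hb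
        · exact hcore b hb
        · exact absurd (Finset.mem_filter.1 hb).2.1.2 hi
      exact (Finset.card_le_card hsub).trans (by omega)

/-- One of the two cliques of `cliquePair`. -/
def cliquePairClique (r : ℕ) (s : Bool) : Finset (Option (Bool × Fin r)) :=
  insert none (univ.map ⟨fun i => some (s, i), fun i j hij => by simpa using hij⟩)

lemma card_cliquePairClique (r : ℕ) (s : Bool) : #(cliquePairClique r s) = r + 1 := by
  rw [cliquePairClique, Finset.card_insert_of_notMem (by simp)]
  simp

lemma mem_cliquePairClique {r : ℕ} {s : Bool} {a : Option (Bool × Fin r)} :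
    a ∈ cliquePairClique r s ↔ a = none ∨ ∃ i, a = some (s, i) := by
  rw [cliquePairClique, Finset.mem_insert, Finset.mem_map]
  exact or_congr_right ⟨fun ⟨i, _, hi⟩ => ⟨i, hi.symm⟩,
    fun ⟨i, hi⟩ => ⟨i, Finset.mem_univ i, hi.symm⟩⟩

lemma cliquePair_adj_of_mem_clique {r : ℕ} {s : Bool} {a b : Option (Bool × Fin r)}
    (ha : a ∈ cliquePairClique r s) (hb : b ∈ cliquePairClique r s) (hab : a ≠ b) :
    (cliquePair r).Adj (.inl a) (.inl b) := by
  rw [mem_cliquePairClique] at ha hb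
  rcases ha with rfl | ⟨i, rfl⟩ <;> rcases hb with rfl | ⟨j, rfl⟩
  · exact absurd rfl hab
  · trivial
  · trivial
  · exact ⟨rfl, by simpa using hab⟩

lemma cliquePair_adj_end {r : ℕ} (hr : 0 < r) {s : Bool} {a : Option (Bool × Fin r)}
    (ha : a ∈ cliquePairClique r s) (hne : a ≠ some (s, ⟨r - 1, by omega⟩)) :
    (cliquePair r).Adj (.inl a) (.inr s) := by
  rw [mem_cliquePairClique] at ha
  rcases ha with rfl | ⟨i, rfl⟩
  · trivial
  · refine ⟨rfl, ?_⟩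
    have : (i : ℕ) ≠ r - 1 := by simpa [Fin.ext_iff] using hne
    omega

end Template

section SwitchingCount

variable {h n r : ℕ} {H : SimpleGraph (Fin h)} {G : SimpleGraph (Fin n)}

open Classical in
lemma le_card_common_neighbors {η : ℝ} (hη : 0 ≤ η) (hη₁ : η ≤ 1) (hr : 0 < r)
    (hdeg : ∀ v : Fin n, (1 - 1 / (r : ℝ) + η) * n ≤ (odeg G v : ℝ)) (A : Finset (Fin n))
    (hA : #A ≤ r) : η * n ≤ #{w | ∀ a ∈ A, G.Adj a w} := by
  have hr' : (0 : ℝ) < r := by exact_mod_cast hr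
  have hnon : ∀ a : Fin n, (#{w | ¬ G.Adj a w} : ℝ) ≤ (1 / r - η) * n := by
    intro a
    have h1 : odeg G a = #{w | G.Adj a w} := by
      rw [odeg, ← Set.ncard_coe_finset]
      congr 1
      ext w
      simp
    have h2 := Finset.card_filter_add_card_filter_not (s := (univ : Finset (Fin n))) (G.Adj a)
    have h3 := hdeg a
    rw [Finset.card_univ, Fintype.card_fin] at h2
    rw [h1] at h3
    have h2' : (#{w | G.Adj a w} : ℝ) + #{w | ¬ G.Adj a w} = n := by exact_mod_cast h2
    linarith
  have hcover : (univ : Finset (Fin n)) ⊆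
      ({w | ∀ a ∈ A, G.Adj a w} : Finset (Fin n)) ∪ A.biUnion fun a => {w | ¬ G.Adj a w} := by
    intro w _
    simp only [Finset.mem_union, Finset.mem_filter, Finset.mem_univ, true_and, Finset.mem_biUnion]
    by_contra! hw
    obtain ⟨a, ha, haw⟩ := hw.1
    exact haw (hw.2 a ha)
  have h4 : (n : ℝ) ≤ #{w | ∀ a ∈ A, G.Adj a w} + ∑ a ∈ A, (#{w | ¬ G.Adj a w} : ℝ) := by
    have := (Finset.card_le_card hcover).trans
      ((Finset.card_union_le _ _).trans (Nat.add_le_add_left Finset.card_biUnion_le _))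
    rw [Finset.card_univ, Fintype.card_fin] at this
    exact_mod_cast this
  have hn : (0 : ℝ) ≤ n := n.cast_nonneg
  rcases A.eq_empty_or_nonempty with hA₀ | ⟨a, ha⟩
  · simp only [hA₀, Finset.sum_empty, add_zero] at h4 ⊢
    nlinarith
  · have h5 : 0 ≤ (1 / r - η) * n := le_trans (Nat.cast_nonneg _) (hnon a)
    have h6 : ∑ a ∈ A, (#{w | ¬ G.Adj a w} : ℝ) ≤ r * ((1 / r - η) * n) := by
      refine (Finset.sum_le_sum fun a _ => hnon a).trans ?_
      rw [Finset.sum_const, nsmul_eq_mul]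
      have : (#A : ℝ) ≤ r := by exact_mod_cast hA
      gcongr
    have h7 : (r : ℝ) * ((1 / r - η) * n) = n - r * η * n := by field_simp
    have h8 : (1 : ℝ) ≤ r := by exact_mod_cast hr
    nlinarith [mul_nonneg hη hn]

/-- Unless the vertices `U m` fail to be distinct from each other and from `x ≠ y`, they contain
a set that can be tiled together with either one of `x` and `y`. -/
def IsSwitch {M : Type*} [Fintype M] (H : SimpleGraph (Fin h)) (G : SimpleGraph (Fin n))
    (x y : Fin n) (U : M → Fin n) : Prop :=
  U.Injective → (∀ m, U m ≠ x) → (∀ m, U m ≠ y) → x ≠ y → ∃ S ⊆ univ.image U,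
    HasPerfectTilingOn H G (insert x S) ∧ HasPerfectTilingOn H G (insert y S)

open Classical in
lemma pow_le_card_homs {η : ℝ} (hη : 0 < η) (hη₁ : η ≤ 1) (hr : 2 ≤ r) (hn : 0 < n)
    (hdeg : ∀ v : Fin n, (1 - 1 / (r : ℝ) + η) * n ≤ (odeg G v : ℝ)) (x : Bool → Fin n) :
    (η * n) ^ Fintype.card (Option (Bool × Fin r)) ≤
      #{v : Option (Bool × Fin r) → Fin n | ∀ a b, (cliquePair r).Adj a b →
        G.Adj (Sum.elim v x a) (Sum.elim v x b)} := by
  have : Nonempty (Fin n) := ⟨⟨0, hn⟩⟩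
  refine (pow_card_le_card_of_allowed (α := Fin n) (cliquePairRank r)
    (fun a v => {w | ∀ b ∈ (cliquePairPrev r a).image (Sum.elim v x), G.Adj b w}) (m := η * n)
    (by positivity) ?_ ?_).trans ?_
  · intro a v w hvw
    have : (cliquePairPrev r a).image (Sum.elim v x) =
        (cliquePairPrev r a).image (Sum.elim w x) := by
      refine Finset.image_congr fun b hb => ?_
      rcases b with b | s
      · exact hvw b ((Finset.mem_filter.1 hb).2.2 b rfl)
      · rfl
    simp only [this]
  · intro a v
    exact le_card_common_neighbors hη.le hη₁ (by omega) hdeg _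
      (Finset.card_image_le.trans (card_cliquePairPrev_le hr a))
  · rw [Nat.cast_le]
    refine Finset.card_le_card fun v hv => ?_
    simp only [Finset.mem_filter, Finset.mem_univ, true_and] at hv ⊢
    have hprev : ∀ a b, b ∈ cliquePairPrev r a → G.Adj (Sum.elim v x b) (v a) :=
      fun a b hb => hv a _ (Finset.mem_image_of_mem _ hb)
    have hend : ∀ a s, (cliquePair r).Adj (.inr s) (.inl a) → G.Adj (x s) (v a) :=
      fun a s hab => hprev a (.inr s) (by simpa [cliquePairPrev] using hab)
    rintro (a | s) (b | s') hab
    · rcases lt_or_gt_of_ne (cliquePairRank_ne hab) with hlt | hlt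
      · exact hprev b (.inl a) (by simpa [cliquePairPrev] using ⟨hab, hlt⟩)
      · exact (hprev a (.inl b) (by simpa [cliquePairPrev] using ⟨hab.symm, hlt⟩)).symm
    · exact (hend a s' hab.symm).symm
    · exact hend b s hab
    · exact absurd hab id

open Classical in
lemma exists_pos_le_card_isSwitch {η : ℝ} (hη : 0 < η) (hη₁ : η ≤ 1) (hr : 2 ≤ r)
    {c : Fin h → Fin r} (hc : Monotone c) (hsurj : c.Surjective)
    (hH : ∀ i j, H.Adj i j → c i ≠ c j) :
    ∃ (M : Type) (_ : Fintype M) (_ : DecidableEq M) (ε : ℝ), 0 < ε ∧ ∀ n : ℕ, 0 < n →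
      ∀ G : SimpleGraph (Fin n),
      (∀ v : Fin n, (1 - 1 / (r : ℝ) + η) * n ≤ (odeg G v : ℝ)) → ∀ x y : Fin n,
      ε * n ^ Fintype.card M ≤ #{U : M → Fin n | IsSwitch H G x y U} := by
  set κ := Option (Bool × Fin r)
  set ι := (κ ⊕ Bool) × Option (Fin h)
  set N := Fintype.card (κ ⊕ Bool → κ ⊕ Bool → Bool) with hN
  have hNpos : 0 < N := Fintype.card_pos
  refine ⟨κ × ι, inferInstance, inferInstance,
    (η ^ Fintype.card κ / N) ^ (Fintype.card ι ^ Fintype.card κ), by positivity, ?_⟩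
  intro n hn G hdeg x₀ x₁
  have : Nonempty (Fin n) := ⟨⟨0, hn⟩⟩
  set x : Bool → Fin n := fun s => bif s then x₁ else x₀ with hxdef
  set homs : Finset (κ → Fin n) := {v | ∀ a b, (cliquePair r).Adj a b →
    G.Adj (Sum.elim v x a) (Sum.elim v x b)}
  have hhoms : (η * n) ^ Fintype.card κ ≤ #homs := pow_le_card_homs hη hη₁ hr hn hdeg x
  set type : (κ → Fin n) → κ ⊕ Bool → κ ⊕ Bool → Bool := fun v a b =>
    decide (Sum.elim v x a < Sum.elim v x b)
  obtain ⟨τ, -, hτ⟩ := Finset.exists_le_card_fiber_of_nsmul_le_card_of_maps_to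
    (s := homs) (t := univ) (f := type) (b := (#homs : ℝ) / N) (fun _ _ => Finset.mem_univ _)
    Finset.univ_nonempty (by
      rw [Finset.card_univ, ← hN, nsmul_eq_mul]
      field_simp
      exact le_rfl)
  obtain ⟨P, hP⟩ : ∃ P : (κ → Fin n) → Prop, ∀ v, P v ↔ v ∈ homs ∧ type v = τ :=
    ⟨_, fun _ => Iff.rfl⟩
  have hblow := density_pow_le_card_blowup (ι := ι) P
  have hfilter : ({v | P v} : Finset (κ → Fin n)) = {v ∈ homs | type v = τ} := by
    ext v; simp [hP]
  rw [hfilter, Fintype.card_fin] at hblow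
  have hn' : (0 : ℝ) < n := by exact_mod_cast hn
  have hdens : η ^ Fintype.card κ / N ≤
      (#{v ∈ homs | type v = τ} : ℝ) / (n : ℝ) ^ Fintype.card κ := by
    rw [le_div_iff₀ (by positivity), div_mul_eq_mul_div, ← mul_pow]
    exact le_trans (by gcongr) hτ
  have hsub : #{W : κ → ι → Fin n | ∀ s : κ → ι, P fun a => W a (s a)} ≤
      #{U : κ × ι → Fin n | IsSwitch H G x₀ x₁ U} := by
    refine Finset.card_le_card_of_injOn Function.uncurry ?_
      (Function.LeftInverse.injective Function.curry_uncurry).injOn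
    intro W hW
    simp only [Finset.coe_filter, Finset.mem_univ, true_and, Set.mem_ofPred_eq, hP] at hW ⊢
    intro hinj hx₀ hx₁ hne
    refine exists_switching_set (D := cliquePair r) (C := cliquePairClique r) (t := none)
      (e := fun s => some (s, ⟨r - 1, by omega⟩)) (x := x) (card_cliquePairClique r)
      (fun s => mem_cliquePairClique.2 (Or.inl rfl))
      (fun s => mem_cliquePairClique.2 (Or.inr ⟨_, rfl⟩))
      (fun s a ha b hb => cliquePair_adj_of_mem_clique ha hb)
      (fun s a ha => cliquePair_adj_end (by omega) ha) hc hsurj (by omega) hH ?_ hinj ?_ ?_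
    · rintro (_ | _) (_ | _) heq
      · rfl
      · exact absurd heq hne
      · exact absurd heq.symm hne
      · rfl
    · rintro a t (_ | _)
      · exact hx₀ (a, t)
      · exact hx₁ (a, t)
    · intro a b hab
      have hval : ∀ t t', ∃ s : κ → ι,
          nodeVertex x W a t = Sum.elim (fun k => W k (s k)) x a ∧
          nodeVertex x W b t' = Sum.elim (fun k => W k (s k)) x b := by
        intro t t'
        refine ⟨fun k => if Sum.inl k = a then t else t', ?_, ?_⟩
        · rcases a with a | s <;> simp [nodeVertex]
        · rcases b with b | s
          · simp [nodeVertex, hab.ne']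
          · simp [nodeVertex]
      intro t t' u u'
      obtain ⟨s, hs₁, hs₂⟩ := hval t t'
      obtain ⟨s', hs₁', hs₂'⟩ := hval u u'
      rw [hs₁, hs₂, hs₁', hs₂']
      refine ⟨(Finset.mem_filter.1 (hW s).1).2 a b hab, fun hlt => ?_⟩
      have h1 := congrFun (congrFun ((hW s).2.trans (hW s').2.symm) a) b
      simp only [type, decide_eq_decide] at h1
      exact h1.1 hlt
  refine le_trans ?_ (hblow.trans (Nat.cast_le.2 hsub))
  rw [Fintype.card_prod κ ι]
  gcongr

end SwitchingCount

section Absorbers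

variable {h n : ℕ} {H : SimpleGraph (Fin h)} {G : SimpleGraph (Fin n)}

open Classical in
lemma IsCopySet.exists_enumeration {T : Finset (Fin n)} (hT : IsCopySet H G T) {i₀ : Fin h}
    {y : Fin n} (hy : y ∈ T) :
    ∃ t : Fin h → Fin n, t.Injective ∧ univ.image t = T ∧ t i₀ = y := by
  obtain ⟨φ, hφ, rfl⟩ := hT
  obtain ⟨j, -, rfl⟩ := Finset.mem_image.1 hy
  refine ⟨φ ∘ Equiv.swap i₀ j, hφ.1.injective.comp (Equiv.injective _), ?_, by simp⟩
  rw [← Finset.image_image, Finset.image_univ_equiv]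

open Classical in
/-- If `t` enumerates a copy of `H` through `q i₀`, and every other `t i` can be switched with `q i`
by means of a set `S i`, then these sets together with the vertices `t i` form an absorbing set for
the set of the vertices `q i`. -/
lemma isDisjointAbsorber_biUnion {i₀ i₁ : Fin h} (hi : i₁ ≠ i₀) {q t : Fin h → Fin n}
    (hq : q.Injective) (ht : t.Injective) (htq : t i₀ = q i₀)
    (hcopy : IsCopySet H G (univ.image t)) {S : Fin h → Finset (Fin n)}
    (hSt : ∀ i ≠ i₀, HasPerfectTilingOn H G (insert (t i) (S i)))
    (hSq : ∀ i ≠ i₀, HasPerfectTilingOn H G (insert (q i) (S i)))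
    (hSS : ∀ i ≠ i₀, ∀ j ≠ i₀, i ≠ j → Disjoint (S i) (S j))
    (htS : ∀ i ≠ i₀, ∀ j ≠ i₀, t i ∉ S j) (hqS : ∀ i, ∀ j ≠ i₀, q i ∉ S j)
    (hqt : ∀ i, ∀ j ≠ i₀, q i ≠ t j) :
    IsDisjointAbsorber H G ((univ.erase i₀).biUnion fun i => insert (t i) (S i))
      (univ.image q) := by
  have hdisj : Disjoint ((univ.erase i₀).biUnion fun i => insert (t i) (S i)) (univ.image q) := by
    rw [Finset.disjoint_biUnion_left]
    intro j hj
    have hj := Finset.ne_of_mem_erase hj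
    rw [Finset.disjoint_right]
    intro z hz
    obtain ⟨i, -, rfl⟩ := Finset.mem_image.1 hz
    rw [Finset.mem_insert, not_or]
    exact ⟨hqt i j hj, hqS i j hj⟩
  refine ⟨⟨t i₁, ?_⟩, hdisj, ?_, ?_⟩
  · exact Finset.mem_biUnion.2 ⟨i₁, by simp [hi], by simp⟩
  · refine HasPerfectTilingOn.biUnion _ _ (fun i hi => hSt i (Finset.ne_of_mem_erase hi)) ?_
    intro i hi j hj hij
    have hi := Finset.ne_of_mem_erase hi
    have hj := Finset.ne_of_mem_erase hj
    simp only [Function.onFun]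
    rw [Finset.disjoint_insert_left, Finset.disjoint_insert_right, Finset.mem_insert, not_or]
    exact ⟨⟨ht.ne hij, htS i hi j hj⟩, htS j hj i hi, hSS i hi j hj hij⟩
  · have hunion : ((univ.erase i₀).biUnion fun i => insert (t i) (S i)) ∪ univ.image q =
        univ.image t ∪ (univ.erase i₀).biUnion fun i => insert (q i) (S i) := by
      ext z
      simp only [Finset.mem_union, Finset.mem_biUnion, Finset.mem_erase, Finset.mem_univ, and_true,
        Finset.mem_insert, Finset.mem_image, true_and]
      constructor
      · rintro (⟨i, hi, rfl | hz⟩ | ⟨i, rfl⟩)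
        · exact Or.inl ⟨i, rfl⟩
        · exact Or.inr ⟨i, hi, Or.inr hz⟩
        · by_cases hi : i = i₀
          · exact Or.inl ⟨i₀, by rw [htq, hi]⟩
          · exact Or.inr ⟨i, hi, Or.inl rfl⟩
      · rintro (⟨i, rfl⟩ | ⟨i, hi, rfl | hz⟩)
        · by_cases hi : i = i₀
          · exact Or.inr ⟨i₀, by rw [← htq, hi]⟩
          · exact Or.inl ⟨i, hi, Or.inl rfl⟩
        · exact Or.inr ⟨i, rfl⟩
        · exact Or.inl ⟨i, hi, Or.inr hz⟩
    rw [hunion]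
    refine (HasPerfectTilingOn.of_isCopySet hcopy).union
      (HasPerfectTilingOn.biUnion _ _ (fun i hi => hSq i (Finset.ne_of_mem_erase hi)) ?_) ?_
    · intro i hi j hj hij
      have hi := Finset.ne_of_mem_erase hi
      have hj := Finset.ne_of_mem_erase hj
      simp only [Function.onFun]
      rw [Finset.disjoint_insert_left, Finset.disjoint_insert_right, Finset.mem_insert, not_or]
      exact ⟨⟨hq.ne hij, hqS i j hj⟩, hqS j i hi, hSS i hi j hj hij⟩
    · rw [Finset.disjoint_biUnion_right]
      intro j hj
      have hj := Finset.ne_of_mem_erase hj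
      rw [Finset.disjoint_left]
      intro z hz
      obtain ⟨i, -, rfl⟩ := Finset.mem_image.1 hz
      rw [Finset.mem_insert, not_or]
      by_cases hi : i = i₀
      · rw [hi, htq]
        exact ⟨hq.ne hj.symm, hqS i₀ j hj⟩
      · exact ⟨(hqt j i hi).symm, htS i hi j hj⟩

open Classical in
lemma pow_le_card_absorbers {M : Type} [Fintype M] [DecidableEq M] {ε : ℝ} (hε : 0 < ε)
    (hh : 2 ≤ h) (hn : 0 < n)
    (hswitch : ∀ x y : Fin n, ε * n ^ Fintype.card M ≤ #{U : M → Fin n | IsSwitch H G x y U})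
    {Q : Finset (Fin n)} (hQ : #Q = h) :
    ε ^ h * n ^ Fintype.card (Fin h × M) ≤ #{U : Fin h × M → Fin n |
      U.Injective → (∀ m, U m ∉ Q) → ∃ S ⊆ univ.image U, IsDisjointAbsorber H G S Q} := by
  have : Nonempty (Fin n) := ⟨⟨0, hn⟩⟩
  set q : Fin h → Fin n := ⇑(Q.orderEmbOfFin hQ)
  have hq : q.Injective := (Q.orderEmbOfFin hQ).injective
  have hqQ : univ.image q = Q := by
    rw [← Finset.coe_inj, Finset.coe_image, Finset.coe_univ, Set.image_univ]
    exact Finset.range_orderEmbOfFin Q hQ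
  have hqmem : ∀ i, q i ∈ Q := fun i => Finset.orderEmbOfFin_mem Q hQ i
  set i₀ : Fin h := ⟨0, by omega⟩
  set i₁ : Fin h := ⟨1, by omega⟩
  have hi : i₁ ≠ i₀ := by simp [i₀, i₁]
  have hcopies : ∀ U : M → Fin n, ∃ t : Fin h → Fin n, IsSwitch H G (q i₀) (q i₁) U →
      U.Injective → (∀ m, U m ∉ Q) → t.Injective ∧ t i₀ = q i₀ ∧ IsCopySet H G (univ.image t) ∧
        ∀ i ≠ i₀, t i ∈ univ.image U := by
    intro U
    by_cases hU : IsSwitch H G (q i₀) (q i₁) U ∧ U.Injective ∧ ∀ m, U m ∉ Q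
    · obtain ⟨S, hSU, hS, -⟩ := hU.1 hU.2.1 (fun m hm => hU.2.2 m (hm ▸ hqmem _))
        (fun m hm => hU.2.2 m (hm ▸ hqmem _)) (hq.ne hi.symm)
      obtain ⟨T, hTS, hT, hqT⟩ := hS.exists_mem (Finset.mem_insert_self _ _)
      obtain ⟨t, ht, rfl, ht₀⟩ := hT.exists_enumeration (i₀ := i₀) hqT
      refine ⟨t, fun _ _ _ => ⟨ht, ht₀, hT, fun i hi => ?_⟩⟩
      rcases Finset.mem_insert.1 (hTS (Finset.mem_image_of_mem t (Finset.mem_univ i))) with h | h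
      · exact absurd (ht (h.trans ht₀.symm)) hi
      · exact hSU h
    · exact ⟨fun _ => q i₀, fun h1 h2 h3 => absurd ⟨h1, h2, h3⟩ hU⟩
  choose t ht using hcopies
  set y : Fin h → (Fin h → M → Fin n) → Fin n := fun i U =>
    if i = i₀ then q i₁ else t (U i₀) i with hy
  have hcount := pow_card_le_card_of_allowed (α := M → Fin n)
    (fun i : Fin h => if i = i₀ then 0 else 1)
    (fun i U => {u : M → Fin n | IsSwitch H G (q i) (y i U) u}) (m := ε * n ^ Fintype.card M)
    (by positivity) (by
      intro i U U' hUU'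
      by_cases hi : i = i₀
      · simp [hy, hi]
      · have := hUU' i₀ (by simp [hi])
        simp only [hy, this]) (fun i U => hswitch _ _)
  rw [Fintype.card_fin, mul_pow, ← pow_mul, mul_comm (Fintype.card M)] at hcount
  rw [Fintype.card_prod, Fintype.card_fin]
  refine hcount.trans (Nat.cast_le.2 ?_)
  refine Finset.card_le_card_of_injOn Function.uncurry ?_
    (Function.LeftInverse.injective Function.curry_uncurry).injOn
  intro U hU
  simp only [Finset.coe_filter, Finset.mem_univ, true_and, Set.mem_ofPred_eq,
    Finset.mem_filter] at hU ⊢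
  intro hinj havoid
  have hinj' : ∀ i m j m', U i m = U j m' → i = j ∧ m = m' := fun i m j m' heq =>
    Prod.ext_iff.1 (@hinj (i, m) (j, m') heq)
  have havoid' : ∀ i m, U i m ∉ Q := fun i m => havoid (i, m)
  have hUinj : ∀ i, (U i).Injective := fun i m m' heq => (hinj' _ _ _ _ heq).2
  obtain ⟨htinj, htq, hcopy, htU⟩ := ht (U i₀) (by simpa [hy] using hU i₀) (hUinj i₀) (havoid' i₀)
  have hS : ∀ i, ∃ S : Finset (Fin n), i ≠ i₀ → S ⊆ univ.image (U i) ∧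
      HasPerfectTilingOn H G (insert (q i) S) ∧
      HasPerfectTilingOn H G (insert (t (U i₀) i) S) := by
    intro i
    by_cases hi : i = i₀
    · exact ⟨∅, fun h => absurd hi h⟩
    · have hUi := hU i
      simp only [hy, if_neg hi] at hUi
      obtain ⟨m, -, hm⟩ := Finset.mem_image.1 (htU i hi)
      obtain ⟨S, hSU, hS⟩ := hUi (hUinj i) (fun m hm => havoid' i m (hm ▸ hqmem _))
        (fun m' hm' => hi (hinj' _ _ _ _ (hm'.trans hm.symm)).1)
        (fun heq => havoid' i₀ m (by rw [hm, ← heq]; exact hqmem _))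
      exact ⟨S, fun _ => ⟨hSU, hS⟩⟩
  choose S hS using hS
  have hSU : ∀ i ≠ i₀, ∀ z ∈ S i, ∃ m, U i m = z := fun i hi z hz => by
    simpa using (hS i hi).1 hz
  have htU' : ∀ i ≠ i₀, ∃ m, U i₀ m = t (U i₀) i := fun i hi => by simpa using htU i hi
  refine ⟨(univ.erase i₀).biUnion fun i => insert (t (U i₀) i) (S i), ?_, ?_⟩
  · rw [Finset.biUnion_subset]
    intro i hi
    have hi := Finset.ne_of_mem_erase hi
    intro z hz
    rw [Finset.mem_image]
    rcases Finset.mem_insert.1 hz with rfl | hz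
    · obtain ⟨m, hm⟩ := htU' i hi
      exact ⟨(i₀, m), Finset.mem_univ _, hm⟩
    · obtain ⟨m, hm⟩ := hSU i hi z hz
      exact ⟨(i, m), Finset.mem_univ _, hm⟩
  · rw [← hqQ]
    refine isDisjointAbsorber_biUnion hi hq htinj htq hcopy (fun i hi => (hS i hi).2.2)
      (fun i hi => (hS i hi).2.1) ?_ ?_ ?_ ?_
    · intro i hi j hj hij
      rw [Finset.disjoint_left]
      intro z hz hz'
      obtain ⟨m, rfl⟩ := hSU i hi z hz
      obtain ⟨m', hm'⟩ := hSU j hj _ hz'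
      exact hij (hinj' _ _ _ _ hm').1.symm
    · intro i hi j hj hz
      obtain ⟨m, hm⟩ := htU' i hi
      obtain ⟨m', hm'⟩ := hSU j hj _ hz
      exact hj (hinj' _ _ _ _ (hm'.trans hm.symm)).1
    · intro i j hj hz
      obtain ⟨m, hm⟩ := hSU j hj _ hz
      exact havoid' j m (hm ▸ hqmem i)
    · intro i j hj heq
      obtain ⟨m, hm⟩ := htU' j hj
      exact havoid' i₀ m (by rw [hm, ← heq]; exact hqmem i)

open Classical in
/-- A positive proportion of the tuples contain an absorbing set for `Q` that avoids a small set
`F`. -/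
lemma le_card_absorbers_avoiding {J : Type*} [Fintype J] [DecidableEq J] {ε : ℝ} (hn : 0 < n)
    {Q F : Finset (Fin n)} (hF : #F + #Q + Fintype.card J ≤ n)
    (hcount : ε * n ^ Fintype.card J ≤ #{U : J → Fin n |
      U.Injective → (∀ m, U m ∉ Q) → ∃ S ⊆ univ.image U, IsDisjointAbsorber H G S Q}) :
    (ε - Fintype.card J * ((#F + #Q + Fintype.card J : ℝ) / n)) * n ^ Fintype.card J ≤
      #{U : J → Fin n | ∃ S ⊆ univ.image U, IsDisjointAbsorber H G S Q ∧ Disjoint S F} := by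
  have : Nonempty (Fin n) := ⟨⟨0, hn⟩⟩
  have hFQ : #(F ∪ Q) ≤ #F + #Q := Finset.card_union_le _ _
  have hinj := card_injective_avoiding_ge (κ := J) (F ∪ Q) (by rw [Fintype.card_fin]; omega)
  rw [Fintype.card_fin] at hinj
  set A : Finset (J → Fin n) := {U : J → Fin n |
      U.Injective → (∀ m, U m ∉ Q) → ∃ S ⊆ univ.image U, IsDisjointAbsorber H G S Q}
  set B : Finset (J → Fin n) := {U : J → Fin n | U.Injective ∧ ∀ a, U a ∉ F ∪ Q}
  have hAB : A ∩ B ⊆ ({U : J → Fin n | ∃ S ⊆ univ.image U,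
      IsDisjointAbsorber H G S Q ∧ Disjoint S F} : Finset (J → Fin n)) := by
    intro U hU
    simp only [A, B, Finset.mem_inter, Finset.mem_filter, Finset.mem_univ, true_and,
      Finset.mem_union, not_or] at hU ⊢
    obtain ⟨S, hSU, hS⟩ := hU.1 hU.2.1 fun m => (hU.2.2 m).2
    refine ⟨S, hSU, hS, Finset.disjoint_of_subset_left hSU ?_⟩
    rw [Finset.disjoint_left]
    intro z hz
    obtain ⟨m, -, rfl⟩ := Finset.mem_image.1 hz
    exact (hU.2.2 m).1
  have h1 := Finset.card_union_add_card_inter A B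
  have h2 : #(A ∪ B) ≤ n ^ Fintype.card J := by
    simpa using Finset.card_le_univ (A ∪ B)
  have h3 : (#A : ℝ) + #B ≤ n ^ Fintype.card J + #(A ∩ B) := by
    have : #A + #B ≤ n ^ Fintype.card J + #(A ∩ B) := by omega
    exact_mod_cast this
  refine le_trans ?_ (Nat.cast_le.2 (Finset.card_le_card hAB))
  have hn' : (0 : ℝ) < n := by exact_mod_cast hn
  have hFQ' : (#(F ∪ Q) : ℝ) ≤ #F + #Q := by exact_mod_cast hFQ
  have h4 : (Fintype.card J : ℝ) * ((#(F ∪ Q) + Fintype.card J : ℝ) / n) * n ^ Fintype.card J ≤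
      Fintype.card J * ((#F + #Q + Fintype.card J : ℝ) / n) * n ^ Fintype.card J := by
    gcongr
  have h5 : ((1 - Fintype.card J * ((#(F ∪ Q) + Fintype.card J : ℝ) / n)) * n ^ Fintype.card J) ≤
      #B := by convert hinj
  rw [sub_mul] at h5 ⊢
  linarith

open Classical in
/-- Passing from tuples containing a set with some property to pairs of a tuple and a set of indices
at which the set is attained. -/
lemma card_le_card_pairs_image {V J : Type*} [Fintype V] [DecidableEq V] [Fintype J]
    [DecidableEq J] (p : Finset V → Prop) :
    #{U : J → V | ∃ S ⊆ univ.image U, p S} ≤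
      #{ω : (J → V) × Finset J | p (ω.2.image ω.1)} := by
  refine Finset.card_le_card_of_surjOn Prod.fst ?_
  intro U hU
  simp only [Finset.coe_filter, Finset.mem_univ, true_and, Set.mem_ofPred_eq] at hU
  obtain ⟨S, hSU, hS⟩ := hU
  obtain ⟨A, -, rfl⟩ := Finset.subset_image_iff.1 hSU
  exact ⟨(U, A), by simpa using hS, rfl⟩

end Absorbers

section Assembly

variable {h : ℕ} {H : SimpleGraph (Fin h)}

/-- An interval colouring with the fewest colours, with the unused colours removed. -/
lemma exists_surjective_coloring (H : SimpleGraph (Fin h)) : ∃ r ≤ intervalChi H,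
    ∃ c : Fin h → Fin r, Monotone c ∧ c.Surjective ∧ ∀ i j, H.Adj i j → c i ≠ c j := by
  have hne : {k | HasIntervalColoring H k}.Nonempty :=
    ⟨h, id, monotone_id, fun i j hij => hij.ne⟩
  obtain ⟨c, hc, hH⟩ := Nat.sInf_mem hne
  set e := (univ.image c).orderIsoOfFin rfl
  have hmem : ∀ i, c i ∈ univ.image c := fun i => Finset.mem_image_of_mem c (Finset.mem_univ i)
  refine ⟨#(univ.image c), (Finset.card_le_univ _).trans (Fintype.card_fin _).le,
    fun i => e.symm ⟨c i, hmem i⟩, ?_, ?_, ?_⟩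
  · exact fun i j hij => e.symm.monotone (Subtype.mk_le_mk.2 (hc hij))
  · intro k
    obtain ⟨i, -, hi⟩ := Finset.mem_image.1 (e k).2
    exact ⟨i, e.symm_apply_eq.2 (Subtype.ext hi)⟩
  · intro i j hij heq
    exact hH i j hij (congrArg Subtype.val (e.symm.injective heq))

open Classical in
lemma exists_absorbing_set {n : ℕ} {G : SimpleGraph (Fin n)} (hn : 0 < n) {J : Type}
    [Fintype J] [DecidableEq J] {c : ℝ} (hc : c ≤ 1) {k L : ℕ} (hh : 0 < h)
    (hcount : ∀ Q : Finset (Fin n), #Q = h → ∀ F : Finset (Fin n), #F ≤ L * Fintype.card J →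
      c * (n ^ Fintype.card J * 2 ^ Fintype.card J) ≤ #{ω : (J → Fin n) × Finset J |
        IsDisjointAbsorber H G (ω.2.image ω.1) Q ∧ Disjoint (ω.2.image ω.1) F})
    (hk : (n : ℝ) ^ h * (1 - c / 2) ^ L < (1 / 2) ^ k) :
    ∃ Abs : Finset (Fin n), #Abs ≤ L * Fintype.card J ∧
      ∀ W, Disjoint W Abs → h ∣ #W → #W ≤ k → IsAbsorbingFor H G Abs W := by
  have : Nonempty (Fin n) := ⟨⟨0, hn⟩⟩
  obtain ⟨𝓕, hd, hA, hcard, hsum⟩ := exists_disjoint_family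
    (I := {Q : Finset (Fin n) // #Q = h})
    (fun ω : (J → Fin n) × Finset J => ω.2.image ω.1)
    (fun S q => IsDisjointAbsorber H G S q.1) hc (m := Fintype.card J) (L := L)
    (fun ω => Finset.card_image_le.trans (Finset.card_le_univ _)) (fun S q hS => hS.1)
    (fun F hF q => by
      convert hcount q.1 q.2 F hF using 2
      simp) L le_rfl
  have htile : ∀ S ∈ 𝓕, HasPerfectTilingOn H G S := fun S hS => by
    obtain ⟨q, hq⟩ := hA S hS
    exact hq.2.2.1
  have hcardI : (Fintype.card {Q : Finset (Fin n) // #Q = h} : ℝ) ≤ n ^ h := by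
    rw [Fintype.card_finset_len, Fintype.card_fin]
    exact_mod_cast Nat.choose_le_pow n h
  refine ⟨𝓕.biUnion id, hcard, fun W hW hdvd hWk =>
    ⟨HasPerfectTilingOn.biUnion _ _ htile hd, ?_⟩⟩
  obtain ⟨l, hl⟩ := hdvd
  refine hasPerfectTilingOn_biUnion_union l 𝓕 hd htile W hl hW fun Q hQ => ?_
  have hlk : l ≤ k := by nlinarith
  have h1 : (1 / 2 : ℝ) ^ #{S ∈ 𝓕 | IsDisjointAbsorber H G S Q} < (1 / 2) ^ k := by
    refine lt_of_le_of_lt (Finset.single_le_sum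
      (f := fun q : {Q : Finset (Fin n) // #Q = h} =>
        (1 / 2 : ℝ) ^ #{S ∈ 𝓕 | IsDisjointAbsorber H G S q.1})
      (fun q _ => by positivity) (Finset.mem_univ ⟨Q, hQ⟩)) ?_
    refine lt_of_le_of_lt hsum (lt_of_le_of_lt ?_ hk)
    exact mul_le_mul_of_nonneg_right hcardI (pow_nonneg (by linarith) _)
  have h2 := (pow_lt_pow_iff_right_of_lt_one₀ (by norm_num) (by norm_num)).1 h1
  omega

lemma eventually_pow_mul_exp_neg_lt_one (k : ℕ) {b : ℝ} (hb : 0 < b) :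
    ∀ᶠ n : ℕ in Filter.atTop, (n : ℝ) ^ k * Real.exp (1 - b * n) < 1 := by
  have h1 := (Real.tendsto_pow_mul_exp_neg_atTop_nhds_zero k).comp
    ((Filter.tendsto_id.const_mul_atTop hb).comp tendsto_natCast_atTop_atTop)
  have h2 := h1.const_mul (Real.exp 1 / b ^ k)
  rw [mul_zero] at h2
  filter_upwards [h2.eventually_lt_const one_pos] with n hn
  refine lt_of_eq_of_lt ?_ hn
  simp only [Function.comp, id]
  rw [sub_eq_add_neg, Real.exp_add, mul_pow]
  field_simp

/-- The numerical facts needed to choose the number `L` of steps of the greedy selection. -/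
lemma exists_selection_parameters (h m : ℕ) {ε : ℝ} (hε : 0 < ε) (hε₁ : ε ≤ 1) :
    ∃ (c ν : ℝ) (n₀ : ℕ), c ≤ 1 ∧ 0 < ν ∧ ∀ n, n₀ ≤ n → 0 < n ∧ ∃ L : ℕ, L * m ≤ ν * n ∧
      (n : ℝ) ^ h * (1 - c / 2) ^ L < (1 / 2) ^ ⌊ν ^ 3 * n⌋₊ ∧
      ∀ f : ℕ, f ≤ L * m → f + h + m ≤ n ∧
        c * 2 ^ m ≤ ε - m * ((f + h + m : ℝ) / n) := by
  obtain ⟨c, hc₀, hcε, hc⟩ : ∃ c : ℝ, 0 < c ∧ c ≤ ε ∧ c * 2 ^ m = ε / 2 := by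
    refine ⟨ε / 2 / 2 ^ m, by positivity, ?_, by field_simp⟩
    have : (1 : ℝ) ≤ 2 ^ m := one_le_pow₀ (by norm_num)
    exact (div_le_self (by positivity) this).trans (by linarith)
  obtain ⟨ν, hν₀, hνc⟩ : ∃ ν : ℝ, 0 < ν ∧ 4 * (ν * (m + 1)) = c :=
    ⟨c / (4 * (m + 1)), by positivity, by field_simp⟩
  have hm₀ : (0 : ℝ) ≤ m := m.cast_nonneg
  have hν₁ : ν ≤ 1 / 4 := by nlinarith
  obtain ⟨n₀, hn₀⟩ := Filter.eventually_atTop.1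
    (((Filter.eventually_gt_atTop 0).and
      (tendsto_natCast_atTop_atTop.eventually_ge_atTop (2 * (h + m) : ℝ))).and
    ((tendsto_natCast_atTop_atTop.eventually_ge_atTop (4 * (m * (h + m)) / ε : ℝ)).and
      (eventually_pow_mul_exp_neg_lt_one h (pow_pos hν₀ 2))))
  refine ⟨c, ν, n₀, hcε.trans hε₁, hν₀, fun n hn => ?_⟩
  obtain ⟨⟨hn₁, hn₂⟩, hn₃, hn₄⟩ := hn₀ n hn
  have hn' : (0 : ℝ) < n := by exact_mod_cast hn₁
  rw [div_le_iff₀ hε] at hn₃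
  obtain ⟨L, hL₁, hL₂⟩ : ∃ L : ℕ, (L : ℝ) * (m + 1) ≤ ν * n ∧ ν * n < (L + 1) * (m + 1) := by
    refine ⟨⌊ν * n / (m + 1)⌋₊, ?_, ?_⟩
    · rw [← le_div_iff₀ (by positivity)]
      exact Nat.floor_le (by positivity)
    · rw [← div_lt_iff₀ (by positivity)]
      exact Nat.lt_floor_add_one _
  have hLm : (L : ℝ) * m ≤ ν * n := by nlinarith [L.cast_nonneg (α := ℝ)]
  refine ⟨hn₁, L, hLm, ?_, fun f hf => ?_⟩
  · have h1 : (1 - c / 2) ^ L ≤ Real.exp (L * -(c / 2)) := by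
      rw [Real.exp_nat_mul]
      refine pow_le_pow_left₀ (by linarith) ?_ _
      have := Real.add_one_le_exp (-(c / 2))
      linarith
    have h2 : Real.exp (-(ν ^ 3 * n)) ≤ (1 / 2) ^ ⌊ν ^ 3 * n⌋₊ := by
      have h3 : Real.exp (-1) ≤ 1 / 2 := by
        rw [Real.exp_neg, one_div]
        refine inv_anti₀ two_pos ?_
        have := Real.add_one_le_exp 1
        linarith
      refine le_trans ?_ (pow_le_pow_left₀ (Real.exp_pos _).le h3 _)
      rw [← Real.exp_nat_mul, Real.exp_le_exp]
      have := Nat.floor_le (by positivity : 0 ≤ ν ^ 3 * n)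
      linarith
    have h4 : L * -(c / 2) ≤ (1 - ν ^ 2 * n) + -(ν ^ 3 * n) := by
      have h5 : ν * (ν * n) < ν * ((L + 1) * (m + 1)) := mul_lt_mul_of_pos_left hL₂ hν₀
      have h6 : ν ^ 3 * n ≤ ν ^ 2 * n := by
        refine mul_le_mul_of_nonneg_right ?_ hn'.le
        exact pow_le_pow_of_le_one hν₀.le (by linarith) (by norm_num)
      rw [← hνc]
      nlinarith
    calc (n : ℝ) ^ h * (1 - c / 2) ^ L
        ≤ n ^ h * (Real.exp (1 - ν ^ 2 * n) * Real.exp (-(ν ^ 3 * n))) := by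
          rw [← Real.exp_add]
          exact mul_le_mul_of_nonneg_left (h1.trans (Real.exp_le_exp.2 h4)) (by positivity)
      _ < 1 * Real.exp (-(ν ^ 3 * n)) := by
          rw [← mul_assoc]
          exact mul_lt_mul_of_pos_right hn₄ (Real.exp_pos _)
      _ ≤ (1 / 2) ^ ⌊ν ^ 3 * n⌋₊ := by rwa [one_mul]
  · have hf' : (f : ℝ) ≤ ν * n := le_trans (by exact_mod_cast hf) hLm
    constructor
    · have : (f + h + m : ℝ) ≤ n := by nlinarith
      exact_mod_cast this
    · have h2 : (m : ℝ) * ((f + h + m) / n) ≤ ε / 2 := by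
        rw [← mul_div_assoc, div_le_iff₀ hn']
        have h3 : m * (f : ℝ) ≤ m * (ν * n) := mul_le_mul_of_nonneg_left hf' hm₀
        have h4 : m * ν * n ≤ ε / 4 * n := by
          refine mul_le_mul_of_nonneg_right ?_ hn'.le
          nlinarith
        linarith
      linarith

open Classical in
lemma exists_absorbing_set_of_proportion (H : SimpleGraph (Fin h)) (hh : 0 < h) {J : Type}
    [Fintype J] [DecidableEq J] {ε : ℝ} (hε : 0 < ε) :
    ∃ (n₀ : ℕ) (ν : ℝ), 0 < ν ∧ ∀ n : ℕ, n₀ ≤ n → ∀ G : SimpleGraph (Fin n),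
      (0 < n → ∀ Q : Finset (Fin n), #Q = h → ε * n ^ Fintype.card J ≤ #{U : J → Fin n |
        U.Injective → (∀ m, U m ∉ Q) → ∃ S ⊆ univ.image U, IsDisjointAbsorber H G S Q}) →
      ∃ Abs : Finset (Fin n), (#Abs : ℝ) ≤ ν * n ∧
        ∀ W : Finset (Fin n), Disjoint W Abs → h ∣ #W → (#W : ℝ) ≤ ν ^ 3 * n →
          IsAbsorbingFor H G Abs W := by
  obtain ⟨c, ν, n₀, hc, hν, hparam⟩ := exists_selection_parameters h (Fintype.card J)
    (lt_min hε one_pos) (min_le_right ε 1)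
  refine ⟨n₀, ν, hν, fun n hn G hcount => ?_⟩
  obtain ⟨hn₁, L, hLm, hL, hf⟩ := hparam n hn
  have hcount' : ∀ Q : Finset (Fin n), #Q = h → ∀ F : Finset (Fin n),
      #F ≤ L * Fintype.card J →
      c * (n ^ Fintype.card J * 2 ^ Fintype.card J) ≤ #{ω : (J → Fin n) × Finset J |
        IsDisjointAbsorber H G (ω.2.image ω.1) Q ∧ Disjoint (ω.2.image ω.1) F} := by
    intro Q hQ F hF
    obtain ⟨hF₁, hF₂⟩ := hf _ hF
    have h1 := le_card_absorbers_avoiding (F := F) hn₁ (by rwa [hQ]) (hcount hn₁ Q hQ)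
    have h2 := card_le_card_pairs_image (V := Fin n) (J := J)
      fun S => IsDisjointAbsorber H G S Q ∧ Disjoint S F
    refine le_trans ?_ (h1.trans (Nat.cast_le.2 (by convert h2)))
    rw [mul_comm (_ ^ _), ← mul_assoc, hQ]
    refine mul_le_mul_of_nonneg_right (hF₂.trans ?_) (by positivity)
    exact sub_le_sub_right (min_le_left _ _) _
  obtain ⟨Abs, hAbs, habsorb⟩ := exists_absorbing_set (H := H) (G := G) hn₁ (J := J) hc hh
    hcount' hL
  exact ⟨Abs, le_trans (by exact_mod_cast hAbs) hLm,
    fun W hW hdvd hWn => habsorb W hW hdvd (Nat.le_floor hWn)⟩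

end Assembly

theorem absorbing_theorem (h : ℕ) (H : SimpleGraph (Fin h))
    (hedge : ∃ a b : Fin h, H.Adj a b) (η : ℝ) (hη : 0 < η) :
    ∃ (n₀ : ℕ) (ν : ℝ), 0 < ν ∧ ∀ n : ℕ, n₀ ≤ n → ∀ G : SimpleGraph (Fin n),
      (∀ v : Fin n, (1 - 1 / (intervalChi H : ℝ) + η) * n ≤ (odeg G v : ℝ)) →
      ∃ Abs : Finset (Fin n), (Abs.card : ℝ) ≤ ν * n ∧
        ∀ W : Finset (Fin n), Disjoint W Abs → h ∣ W.card →
          (W.card : ℝ) ≤ ν ^ 3 * n → IsAbsorbingFor H G Abs W := by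
  obtain ⟨r, hr, c, hc, hsurj, hH⟩ := exists_surjective_coloring H
  obtain ⟨a, b, hab⟩ := hedge
  have hr₂ : 2 ≤ r := by
    have := Fin.val_ne_of_ne (hH a b hab)
    omega
  have hh : 2 ≤ h := by
    have := Fin.val_ne_of_ne hab.ne
    omega
  obtain ⟨M, _, _, ε, hε, hswitch⟩ := exists_pos_le_card_isSwitch (lt_min hη one_pos)
    (min_le_right η 1) hr₂ hc hsurj hH
  obtain ⟨n₀, ν, hν, habsorb⟩ := exists_absorbing_set_of_proportion H (by omega : 0 < h)
    (J := Fin h × M) (pow_pos hε h)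
  refine ⟨n₀, ν, hν, fun n hn G hG => habsorb n hn G fun hn₁ Q hQ => ?_⟩
  refine pow_le_card_absorbers hε hh hn₁ (fun x y => ?_) hQ
  refine hswitch n hn₁ G (fun v => le_trans ?_ (hG v)) x y
  have hr₀ : (0 : ℝ) < r := by exact_mod_cast (by omega : 0 < r)
  have hr' : 1 / (intervalChi H : ℝ) ≤ 1 / r :=
    one_div_le_one_div_of_le hr₀ (by exact_mod_cast hr)
  refine mul_le_mul_of_nonneg_right ?_ n.cast_nonneg
  linarith [min_le_left η 1]
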